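/- arXiv:2305.03644 — 7 statements merged into one kernel-verified Lean document; each statement's English description precedes it below -/
import Mathlib

section
/- Under the preference assumption, if n_1^{RSD} ∈ {0, …, n} is an equilibrium of the random serial dictatorship within the restricted class of profiles and n_1^{B} ∈ {1, …, n} is an equilibrium of the Boston mechanism within the restricted class of profiles, then n_1^{RSD} ≥ n_1^{B}; that is, in any class equilibrium of RSD, weakly more agents rank good x_1 first than in any class equilibrium of Boston. -/
/-- The object in the earliest position of report `P` (a bijection from
positions to objects) among objects not in `S`. -/
def topPick {n : ℕ} [NeZero n] (P : Equiv.Perm (Fin n)) (S : Finset (Fin n)) : Fin n :=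
  if h : (Finset.univ.filter fun p => P p ∉ S).Nonempty then
    P ((Finset.univ.filter fun p => P p ∉ S).min' h)
  else 0

/-- Objects assigned by the serial dictatorship (with reports `R` and
ordering `π`, both position-indexed) to the agents in the first `k` positions. -/
def sdAssigned {n : ℕ} [NeZero n] (R : Fin n → Equiv.Perm (Fin n))
    (π : Equiv.Perm (Fin n)) : ℕ → Finset (Fin n)
  | 0 => ∅
  | k + 1 =>
    if h : k < n then
      sdAssigned R π k ∪ {topPick (R (π ⟨k, h⟩)) (sdAssigned R π k)}
    else sdAssigned R π k

/-- Serial dictatorship allocation: given reports `R` (for each agent, a bijection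
position → object) and an ordering `π` (position → agent), agent `i` receives the object
in the earliest position of their own report among the objects not assigned to the
agents in earlier positions of `π`. -/
def sdAlloc {n : ℕ} [NeZero n] (R : Fin n → Equiv.Perm (Fin n))
    (π : Equiv.Perm (Fin n)) (i : Fin n) : Fin n :=
  topPick (R i) (sdAssigned R π (π.symm i : ℕ))

/-- The partial assignment (agent → assigned object, if any) after `k` rounds of the
Boston mechanism with reports `R` and tiebreak ordering `π` (position → agent).
In round `k+1`, every unassigned agent `i` points to the object in position `k` of their
report, and receives it iff it is unassigned and `i` is earliest in `π` among the
unassigned agents pointing to it. -/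
def bostonRounds {n : ℕ} [NeZero n] (R : Fin n → Equiv.Perm (Fin n))
    (π : Equiv.Perm (Fin n)) : ℕ → Fin n → Option (Fin n)
  | 0 => fun _ => none
  | k + 1 =>
    if h : k < n then
      fun i =>
        match bostonRounds R π k i with
        | some x => some x
        | none =>
          if (∀ j, bostonRounds R π k j ≠ some (R i ⟨k, h⟩)) ∧
              (∀ j, bostonRounds R π k j = none → R j ⟨k, h⟩ = R i ⟨k, h⟩ →
                (π.symm i : ℕ) ≤ (π.symm j : ℕ)) then
            some (R i ⟨k, h⟩)
          else none
    else bostonRounds R π k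

/-- The Boston-mechanism allocation (after all `n` rounds). -/
def bostonAlloc {n : ℕ} [NeZero n] (R : Fin n → Equiv.Perm (Fin n))
    (π : Equiv.Perm (Fin n)) (i : Fin n) : Fin n :=
  (bostonRounds R π n i).getD 0

/-- Expected utility of agent `i` under the random serial dictatorship (uniform over
the `n !` orderings), where receiving the object in position `j` of one's own report
yields utility `v x + ρ j`. -/
noncomputable def rsdEU {n : ℕ} [NeZero n] (v ρ : Fin n → ℝ)
    (R : Fin n → Equiv.Perm (Fin n)) (i : Fin n) : ℝ :=
  (∑ π : Equiv.Perm (Fin n), (v (sdAlloc R π i) + ρ ((R i).symm (sdAlloc R π i)))) /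
    (Nat.factorial n)

/-- Expected utility of agent `i` under the Boston mechanism with uniformly random
tiebreak ordering. -/
noncomputable def bostonEU {n : ℕ} [NeZero n] (v ρ : Fin n → ℝ)
    (R : Fin n → Equiv.Perm (Fin n)) (i : Fin n) : ℝ :=
  (∑ π : Equiv.Perm (Fin n), (v (bostonAlloc R π i) + ρ ((R i).symm (bostonAlloc R π i)))) /
    (Nat.factorial n)
/-- The positions/objects `{k, k+1, …, n-1}` of `Fin n`, enumerated by `Fin (n - k)`. -/
def offsetEquiv (n k : ℕ) : Fin (n - k) ≃ {x : Fin n // k ≤ (x : ℕ)} where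
  toFun p := ⟨⟨k + (p : ℕ), by have := p.isLt; omega⟩, Nat.le_add_right k p⟩
  invFun x := ⟨(x : ℕ) - k, by have := x.1.isLt; have := x.2; omega⟩
  left_inv p := by ext; simp
  right_inv x := by have := x.2; ext; simp; omega

/-- The class report ranking `x_1` first, `x_2` second, and the tail objects
`x_3, …, x_n` in positions `3, …, n` according to the common order `τ`. -/
def rsdX1Report (n : ℕ) (τ : Equiv.Perm (Fin (n - 2))) : Equiv.Perm (Fin n) :=
  τ.extendDomain (offsetEquiv n 2)

/-- The class report ranking `x_2` first, `x_1` second, and the tail objects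
`x_3, …, x_n` in positions `3, …, n` according to the common order `τ`. -/
def rsdX2Report (n : ℕ) [NeZero n] (τ : Equiv.Perm (Fin (n - 2))) : Equiv.Perm (Fin n) :=
  (rsdX1Report n τ).trans (Equiv.swap 0 1)

/-- The cyclic shift of positions `1 → 2 → ⋯ → n-1 → 1`, fixing position `0`. -/
def shiftPerm (n : ℕ) : Equiv.Perm (Fin n) :=
  (finRotate (n - 1)).extendDomain (offsetEquiv n 1)

/-- The Boston class report ranking `x_1` first, the tail objects `x_3, …, x_n` in
positions `2, …, n-1` according to the common order `τ`, and `x_2` last. -/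
def bostonX1Report (n : ℕ) (τ : Equiv.Perm (Fin (n - 2))) : Equiv.Perm (Fin n) :=
  (shiftPerm n).trans (rsdX1Report n τ)

/-- The Boston class report ranking `x_2` first, the tail objects `x_3, …, x_n` in
positions `2, …, n-1` according to the common order `τ`, and `x_1` last. -/
def bostonX2Report (n : ℕ) [NeZero n] (τ : Equiv.Perm (Fin (n - 2))) : Equiv.Perm (Fin n) :=
  (shiftPerm n).trans (rsdX2Report n τ)

/-- The RSD class-`n₁` profile with common tail order `τ`: the first `n₁` agents rank
`x_1` first and `x_2` second, the remaining agents rank `x_2` first and `x_1` second,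
and all agents place `x_3, …, x_n` in positions `3, …, n` according to `τ`. -/
def rsdClassProfile (n n₁ : ℕ) [NeZero n] (τ : Equiv.Perm (Fin (n - 2))) :
    Fin n → Equiv.Perm (Fin n) :=
  fun i => if (i : ℕ) < n₁ then rsdX1Report n τ else rsdX2Report n τ

/-- The Boston class-`n₁` profile with common tail order `τ`: for `n₁ < n`, the first
`n₁` agents rank `x_1` first and the remaining agents rank `x_2` first, all placing
`x_3, …, x_n` in positions `2, …, n-1` according to `τ` and the remaining object from
`{x_1, x_2}` last; for `n₁ = n`, all agents rank `x_1` first, `x_2` second, and the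
tail objects in positions `3, …, n` according to `τ`. -/
def bostonClassProfile (n n₁ : ℕ) [NeZero n] (τ : Equiv.Perm (Fin (n - 2))) :
    Fin n → Equiv.Perm (Fin n) :=
  if n₁ = n then fun _ => rsdX1Report n τ
  else fun i => if (i : ℕ) < n₁ then bostonX1Report n τ else bostonX2Report n τ

/-- Expected utility of agent `i` for a mechanism `mech` at a profile `prof` depending
on the common tail order `τ`, averaging uniformly over the common tail order `τ` and
the mechanism's random ordering `π`. -/
noncomputable def classEU (n : ℕ) [NeZero n]
    (mech : (Fin n → Equiv.Perm (Fin n)) → Equiv.Perm (Fin n) → Fin n → Fin n)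
    (v ρ : Fin n → ℝ) (prof : Equiv.Perm (Fin (n - 2)) → Fin n → Equiv.Perm (Fin n))
    (i : Fin n) : ℝ :=
  (∑ τ : Equiv.Perm (Fin (n - 2)), ∑ π : Equiv.Perm (Fin n),
      (v (mech (prof τ) π i) + ρ ((prof τ i).symm (mech (prof τ) π i)))) /
    (Nat.factorial (n - 2) * Nat.factorial n)

/-- Expected total welfare (sum over agents of realized utility) for mechanism `mech`
at profile `prof`, averaged over the common tail order and the random ordering. -/
noncomputable def classWelfare (n : ℕ) [NeZero n]
    (mech : (Fin n → Equiv.Perm (Fin n)) → Equiv.Perm (Fin n) → Fin n → Fin n)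
    (v ρ : Fin n → ℝ) (prof : Equiv.Perm (Fin (n - 2)) → Fin n → Equiv.Perm (Fin n)) : ℝ :=
  (∑ τ : Equiv.Perm (Fin (n - 2)), ∑ π : Equiv.Perm (Fin n), ∑ i : Fin n,
      (v (mech (prof τ) π i) + ρ ((prof τ i).symm (mech (prof τ) π i)))) /
    (Nat.factorial (n - 2) * Nat.factorial n)

/-- `n₁` is an equilibrium of RSD within the restricted class of profiles: no single
agent can strictly increase their expected utility by switching which object from
`{x_1, x_2}` they rank first, adopting the corresponding class report (with the same
common tail order), all other agents unchanged. -/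
def rsdClassEq (n n₁ : ℕ) [NeZero n] (v ρ : Fin n → ℝ) : Prop :=
  ∀ i : Fin n,
    classEU n sdAlloc v ρ
        (fun τ => Function.update (rsdClassProfile n n₁ τ) i
          (if (i : ℕ) < n₁ then rsdX2Report n τ else rsdX1Report n τ)) i ≤
      classEU n sdAlloc v ρ (fun τ => rsdClassProfile n n₁ τ) i

/-- `n₁` is an equilibrium of the Boston mechanism within the restricted class of
profiles: no single agent can strictly increase their expected utility by switching
which object from `{x_1, x_2}` they rank first, adopting the corresponding class
report (with the same common tail order), all other agents unchanged. -/
def bostonClassEq (n n₁ : ℕ) [NeZero n] (v ρ : Fin n → ℝ) : Prop :=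
  ∀ i : Fin n,
    classEU n bostonAlloc v ρ
        (fun τ => Function.update (bostonClassProfile n n₁ τ) i
          (if (i : ℕ) < n₁ then bostonX2Report n τ else bostonX1Report n τ)) i ≤
      classEU n bostonAlloc v ρ (fun τ => bostonClassProfile n n₁ τ) i

/-- The preference assumption: all agents share common fundamental values
`v x_1 > v x_2 > v x_3 = ⋯ = v x_n`. -/
def prefAssumption {n : ℕ} (v : Fin n → ℝ) : Prop :=
  (∀ j k : Fin n, j < k → (j : ℕ) < 2 → v k < v j) ∧
    (∀ j k : Fin n, 2 ≤ (j : ℕ) → 2 ≤ (k : ℕ) → v j = v k)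

lemma topPick_eq {n : ℕ} [NeZero n] (P : Equiv.Perm (Fin n)) (S : Finset (Fin n)) (p : Fin n)
    (hp : P p ∉ S) (hlt : ∀ q < p, P q ∈ S) : topPick P S = P p := by
  have hne : (Finset.univ.filter fun p => P p ∉ S).Nonempty := ⟨p, by simpa using hp⟩
  rw [topPick, dif_pos hne]
  congr 1
  apply le_antisymm
  · exact Finset.min'_le _ _ (by simpa using hp)
  · by_contra! h
    have := Finset.min'_mem _ hne
    exact (Finset.mem_filter.1 this).2 (hlt _ h)

section SerialDictatorship

variable {n : ℕ} [NeZero n] {R : Fin n → Equiv.Perm (Fin n)}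

omit [NeZero n] in
lemma symm_lt_of_common_tail {m : ℕ}
    (htail : ∀ j j' (p : Fin n), m ≤ (p : ℕ) → R j p = R j' p) {k : ℕ} (hk : m ≤ k)
    (j j' x : Fin n) (hx : ((R j).symm x : ℕ) < k) : ((R j').symm x : ℕ) < k := by
  by_contra! h
  have h1 := htail j' j ((R j').symm x) (hk.trans h)
  rw [Equiv.apply_symm_apply, ← Equiv.symm_apply_eq] at h1
  rw [h1] at hx
  omega

lemma sdAssigned_one (hn : 3 ≤ n) (π : Equiv.Perm (Fin n)) :
    sdAssigned R π 1 = {R (π 0) 0} := by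
  have h0 : 0 < n := by omega
  have : topPick (R (π ⟨0, h0⟩)) ∅ = R (π 0) 0 :=
    topPick_eq _ _ 0 (by simp) (fun q hq => absurd hq (Fin.not_lt_zero q))
  rw [sdAssigned, dif_pos h0, sdAssigned, this]
  simp

lemma topPick_singleton (hn : 3 ≤ n) (P : Equiv.Perm (Fin n)) (z : Fin n) :
    topPick P {z} = if z = P 0 then P ⟨1, by omega⟩ else P 0 := by
  split_ifs with h
  · apply topPick_eq
    · simp [h, Fin.ext_iff]
    · intro q hq
      have : q = 0 := by
        ext; simp only [Fin.lt_def] at hq; rw [Fin.val_zero]; omega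
      simp [this, h]
  · apply topPick_eq
    · simpa using Ne.symm h
    · exact fun q hq => absurd hq (Fin.not_lt_zero q)

lemma sdAssigned_eq_of_common_tail (hn : 3 ≤ n)
    (htail : ∀ j j' (p : Fin n), 2 ≤ (p : ℕ) → R j p = R j' p) (π : Equiv.Perm (Fin n))
    (i : Fin n) (k : ℕ) (hk : 2 ≤ k) (hkn : k ≤ n) :
    sdAssigned R π k = Finset.univ.filter fun x => ((R i).symm x : ℕ) < k := by
  induction k, hk using Nat.le_induction with
  | base =>
    have h1 : 1 < n := by omega
    set j := π ⟨1, h1⟩ with hj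
    have key : sdAssigned R π 2 = {R j 0, R j ⟨1, h1⟩} := by
      rw [sdAssigned, dif_pos h1, sdAssigned_one hn, topPick_singleton hn, ← hj]
      split_ifs with h
      · rw [h]; rfl
      · have hlt := symm_lt_of_common_tail htail le_rfl (π 0) j (R (π 0) 0) (by simp)
        have hne : (R j).symm (R (π 0) 0) ≠ 0 := by
          rw [Ne, Equiv.symm_apply_eq]; exact h
        have h1' : (R j).symm (R (π 0) 0) = ⟨1, h1⟩ := by
          rw [Ne, Fin.ext_iff] at hne
          simp only [Fin.val_zero] at hne
          ext; simp only; omega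
        rw [Equiv.symm_apply_eq] at h1'
        rw [h1', Finset.union_comm]; rfl
    rw [key]
    ext x
    simp only [Finset.mem_insert, Finset.mem_singleton, Finset.mem_filter, Finset.mem_univ,
      true_and]
    have h2 : ((R i).symm x : ℕ) < 2 ↔ ((R j).symm x : ℕ) < 2 :=
      ⟨symm_lt_of_common_tail htail le_rfl i j x, symm_lt_of_common_tail htail le_rfl j i x⟩
    rw [h2, ← Equiv.symm_apply_eq, ← Equiv.symm_apply_eq, Fin.ext_iff, Fin.ext_iff, Fin.val_zero]
    simp only
    omega
  | succ k hk ih =>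
    have hlt : k < n := by omega
    set j := π ⟨k, hlt⟩ with hj
    have hset : ∀ x, ((R i).symm x : ℕ) < k ↔ ((R j).symm x : ℕ) < k := fun x =>
      ⟨symm_lt_of_common_tail htail hk i j x, symm_lt_of_common_tail htail hk j i x⟩
    have htop : topPick (R j) (sdAssigned R π k) = R j ⟨k, hlt⟩ := by
      rw [ih hlt.le]
      apply topPick_eq
      · simp [hset]
      · intro q hq
        simpa [hset, Fin.lt_def] using hq
    rw [sdAssigned, dif_pos hlt, htop, ih hlt.le, htail j i _ hk]
    ext x
    simp only [Finset.mem_union, Finset.mem_filter, Finset.mem_univ, true_and,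
      Finset.mem_singleton]
    rw [← Equiv.symm_apply_eq, Fin.ext_iff]
    simp only
    omega

lemma sdAlloc_of_two_le (hn : 3 ≤ n)
    (htail : ∀ j j' (p : Fin n), 2 ≤ (p : ℕ) → R j p = R j' p) (π : Equiv.Perm (Fin n))
    (i : Fin n) (hi : 2 ≤ (π.symm i : ℕ)) : sdAlloc R π i = R i (π.symm i) := by
  rw [sdAlloc, sdAssigned_eq_of_common_tail hn htail π i _ hi (π.symm i).isLt.le]
  apply topPick_eq
  · simp
  · intro q hq
    simpa using hq

lemma sdAlloc_of_eq_zero (π : Equiv.Perm (Fin n)) (i : Fin n) (hi : (π.symm i : ℕ) = 0) :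
    sdAlloc R π i = R i 0 := by
  rw [sdAlloc, hi, sdAssigned]
  exact topPick_eq _ _ 0 (by simp) (fun q hq => absurd hq (Fin.not_lt_zero q))

lemma sdAlloc_of_eq_one (hn : 3 ≤ n) (π : Equiv.Perm (Fin n)) (i : Fin n)
    (hi : (π.symm i : ℕ) = 1) :
    sdAlloc R π i = if R (π 0) 0 = R i 0 then R i ⟨1, by omega⟩ else R i 0 := by
  rw [sdAlloc, hi, sdAssigned_one hn, topPick_singleton hn]

end SerialDictatorship

section Reports

variable {n : ℕ} [NeZero n]

omit [NeZero n] in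
lemma rsdX1Report_of_lt_two (τ : Equiv.Perm (Fin (n - 2))) (p : Fin n) (hp : (p : ℕ) < 2) :
    rsdX1Report n τ p = p :=
  Equiv.Perm.extendDomain_apply_not_subtype _ _ (by omega)

omit [NeZero n] in
lemma two_le_rsdX1Report (τ : Equiv.Perm (Fin (n - 2))) (p : Fin n) (hp : 2 ≤ (p : ℕ)) :
    2 ≤ (rsdX1Report n τ p : ℕ) := by
  rw [rsdX1Report, Equiv.Perm.extendDomain_apply_subtype τ (offsetEquiv n 2) hp]
  exact (offsetEquiv n 2 _).2

lemma rsdX2Report_of_two_le (hn : 3 ≤ n) (τ : Equiv.Perm (Fin (n - 2))) (p : Fin n)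
    (hp : 2 ≤ (p : ℕ)) : rsdX2Report n τ p = rsdX1Report n τ p := by
  have h := two_le_rsdX1Report τ p hp
  have h1 : ((1 : Fin n) : ℕ) = 1 := by rw [Fin.val_one', Nat.mod_eq_of_lt (by omega)]
  rw [rsdX2Report, Equiv.trans_apply, Equiv.swap_apply_of_ne_of_ne]
  · intro h'
    rw [h', Fin.val_zero] at h
    omega
  · intro h'
    rw [h', h1] at h
    omega

lemma rsdX2Report_zero (τ : Equiv.Perm (Fin (n - 2))) :
    rsdX2Report n τ 0 = 1 := by
  rw [rsdX2Report, Equiv.trans_apply, rsdX1Report_of_lt_two _ _ (by simp), Equiv.swap_apply_left]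

lemma rsdX2Report_one (hn : 3 ≤ n) (τ : Equiv.Perm (Fin (n - 2))) :
    rsdX2Report n τ 1 = 0 := by
  have h1 : ((1 : Fin n) : ℕ) = 1 := by rw [Fin.val_one', Nat.mod_eq_of_lt (by omega)]
  rw [rsdX2Report, Equiv.trans_apply, rsdX1Report_of_lt_two _ _ (by omega),
    Equiv.swap_apply_right]

lemma shiftPerm_zero : shiftPerm n 0 = 0 :=
  Equiv.Perm.extendDomain_apply_not_subtype _ _ (by simp)

lemma coe_shiftPerm (p : Fin n) (hp : 1 ≤ (p : ℕ)) (hpn : (p : ℕ) + 1 < n) :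
    (shiftPerm n p : ℕ) = p + 1 := by
  rw [shiftPerm, Equiv.Perm.extendDomain_apply_subtype _ (offsetEquiv n 1) hp]
  obtain ⟨m, rfl⟩ : ∃ m, n = m + 2 := ⟨n - 2, by omega⟩
  have h : ((offsetEquiv (m + 2) 1).symm ⟨p, hp⟩ : ℕ) = p - 1 := rfl
  have h2 : (((offsetEquiv (m + 2) 1) (finRotate (m + 1) ((offsetEquiv (m + 2) 1).symm ⟨p, hp⟩)))
      : Fin (m + 2)).val = 1 + (finRotate (m + 1) ((offsetEquiv (m + 2) 1).symm ⟨p, hp⟩)).val := rfl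
  refine h2.trans ?_
  rw [coe_finRotate_of_ne_last]
  · omega
  · intro h'
    rw [Fin.ext_iff] at h'
    simp only [Fin.val_last] at h'
    omega

lemma bostonX1Report_zero (τ : Equiv.Perm (Fin (n - 2))) : bostonX1Report n τ 0 = 0 := by
  rw [bostonX1Report, Equiv.trans_apply, shiftPerm_zero, rsdX1Report_of_lt_two _ _ (by simp)]

lemma bostonX2Report_zero (τ : Equiv.Perm (Fin (n - 2))) : bostonX2Report n τ 0 = 1 := by
  rw [bostonX2Report, Equiv.trans_apply, shiftPerm_zero, rsdX2Report_zero]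

lemma bostonX2Report_tail (hn : 3 ≤ n) (τ : Equiv.Perm (Fin (n - 2))) (p : Fin n)
    (hp : 1 ≤ (p : ℕ)) (hpn : (p : ℕ) + 1 < n) : bostonX2Report n τ p = bostonX1Report n τ p := by
  have := coe_shiftPerm p hp hpn
  rw [bostonX2Report, Equiv.trans_apply, rsdX2Report_of_two_le hn _ _ (by omega)]
  rfl

lemma two_le_bostonX1Report (τ : Equiv.Perm (Fin (n - 2))) (p : Fin n)
    (hp : 1 ≤ (p : ℕ)) (hpn : (p : ℕ) + 1 < n) : 2 ≤ (bostonX1Report n τ p : ℕ) := by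
  have := coe_shiftPerm p hp hpn
  exact two_le_rsdX1Report τ _ (by omega)

end Reports

section Boston

variable {n : ℕ}

/-- The position in their report of the object that an agent `i` obtains from the Boston mechanism
when the agents form two groups (given by `g`) with distinct first choices and a common tail. -/
def bostonPos (g : Fin n → Bool) (π : Equiv.Perm (Fin n)) (i : Fin n) : ℕ :=
  if ∃ j, π.symm j < π.symm i ∧ g j = g i then
    if ∃ j, π.symm j < π.symm i ∧ g j ≠ g i then (π.symm i : ℕ) - 1 else π.symm i
  else 0

lemma bostonPos_eq_zero_iff (g : Fin n → Bool) (π : Equiv.Perm (Fin n)) (i : Fin n) :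
    bostonPos g π i = 0 ↔ ¬ ∃ j, π.symm j < π.symm i ∧ g j = g i := by
  rw [bostonPos]
  split_ifs with h1 h2
  · obtain ⟨j, hj, hgj⟩ := h1
    obtain ⟨j', hj', hgj'⟩ := h2
    have hne : π.symm j ≠ π.symm j' := fun h => hgj' (by rw [← π.symm.injective h, hgj])
    simp only [not_exists, not_and]
    constructor
    · intro h
      omega
    · exact fun h => absurd hgj (h j hj)
  · obtain ⟨j, hj, hgj⟩ := h1
    constructor
    · intro h
      omega
    · exact fun h => absurd ⟨j, hj, hgj⟩ h
  · simpa using h1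

lemma bostonPos_add_one_lt (hn : 3 ≤ n) (g : Fin n → Bool) (π : Equiv.Perm (Fin n))
    (ht : ∃ j, g j = true) (hf : ∃ j, g j = false) (i : Fin n) : bostonPos g π i + 1 < n := by
  rw [bostonPos]
  split_ifs with h1 h2
  · have := (π.symm i).isLt
    omega
  · obtain ⟨j, hj⟩ : ∃ j, g j ≠ g i := by
      cases h : g i
      · simpa using ht
      · simpa using hf
    have hlt : ¬ π.symm j < π.symm i := fun h => h2 ⟨j, h, hj⟩
    have hne : π.symm j ≠ π.symm i := fun h => hj (by rw [π.symm.injective h])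
    have := (π.symm j).isLt
    omega
  · omega

lemma bostonPos_lt_bostonPos (g : Fin n → Bool) (π : Equiv.Perm (Fin n)) {i j : Fin n}
    (hij : π.symm j < π.symm i) (hi : bostonPos g π i ≠ 0) :
    bostonPos g π j < bostonPos g π i := by
  by_cases hj0 : bostonPos g π j = 0
  · omega
  have hi' := (bostonPos_eq_zero_iff g π i).not.1 hi
  have hj' := (bostonPos_eq_zero_iff g π j).not.1 hj0
  rw [not_not] at hi' hj'
  rw [bostonPos, if_pos hj', bostonPos, if_pos hi']
  split_ifs with h1 h2 h2
  · obtain ⟨k, hk, -⟩ := hj'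
    omega
  · exfalso
    obtain ⟨k, hk, hgk⟩ := h1
    obtain ⟨l, hl, hgl⟩ := hj'
    push Not at h2
    exact hgk ((h2 k (hk.trans hij)).trans (h2 j hij).symm)
  · obtain ⟨k, hk, hgk⟩ : ∃ k, π.symm k < π.symm i ∧ g k ≠ g j := by
      by_cases hg : g j = g i
      · obtain ⟨k, hk, hgk⟩ := h2
        exact ⟨k, hk, hg ▸ hgk⟩
      · obtain ⟨k, hk, hgk⟩ := hi'
        exact ⟨k, hk, hgk ▸ Ne.symm hg⟩
    have hkj : ¬ π.symm k < π.symm j := fun h => h1 ⟨k, h, hgk⟩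
    have hne : π.symm k ≠ π.symm j := fun h => hgk (by rw [π.symm.injective h])
    omega
  · exact hij

lemma exists_bostonPos_succ_eq (g : Fin n → Bool) (π : Equiv.Perm (Fin n)) {i : Fin n}
    (hi : 2 ≤ bostonPos g π i) :
    ∃ j, π.symm j < π.symm i ∧ bostonPos g π j + 1 = bostonPos g π i := by
  have hi' := (bostonPos_eq_zero_iff g π i).not.1 (by omega)
  rw [not_not] at hi'
  by_cases h2 : ∃ j, π.symm j < π.symm i ∧ g j ≠ g i
  · have hpos : bostonPos g π i = (π.symm i : ℕ) - 1 := by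
      rw [bostonPos, if_pos hi', if_pos h2]
    have hlt := (π.symm i).isLt
    obtain ⟨j, hj⟩ : ∃ j, (π.symm j : ℕ) = (π.symm i : ℕ) - 1 :=
      ⟨π ⟨(π.symm i : ℕ) - 1, by omega⟩, by simp⟩
    have both : ∀ b, ∃ k, π.symm k < π.symm i ∧ g k = b := by
      intro b
      by_cases hb : b = g i
      · rw [hb]; exact hi'
      · obtain ⟨k, hk, hgk⟩ := h2
        refine ⟨k, hk, ?_⟩
        revert hb hgk
        cases g k <;> cases g i <;> cases b <;> simp
    have hcases : ∀ k, π.symm k < π.symm i → π.symm k < π.symm j ∨ k = j := by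
      intro k hk
      by_cases hkj : k = j
      · exact Or.inr hkj
      · have : π.symm k ≠ π.symm j := fun h => hkj (π.symm.injective h)
        left
        omega
    by_cases hw : bostonPos g π j = 0
    · have hw' := (bostonPos_eq_zero_iff g π j).1 hw
      push Not at hw'
      obtain ⟨l, hl⟩ : ∃ l, (π.symm l : ℕ) = (π.symm i : ℕ) - 2 :=
        ⟨π ⟨(π.symm i : ℕ) - 2, by omega⟩, by simp⟩
      obtain ⟨m, hm⟩ : ∃ m, (π.symm m : ℕ) = 0 := ⟨π ⟨0, by omega⟩, by simp⟩
      have hsame : ∀ k, π.symm k < π.symm j → g k = g l := by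
        intro k hk
        have h3 := hw' k hk
        have h4 := hw' l (by omega)
        revert h3 h4
        cases g k <;> cases g l <;> cases g j <;> simp
      refine ⟨l, by omega, ?_⟩
      rw [bostonPos, if_pos ⟨m, by omega, hsame m (by omega)⟩, if_neg]
      · omega
      · rintro ⟨k, hk, hgk⟩
        exact hgk (hsame k (by omega))
    · have hw' := (bostonPos_eq_zero_iff g π j).not.1 hw
      rw [not_not] at hw'
      refine ⟨j, by omega, ?_⟩
      rw [bostonPos, if_pos hw', if_pos]
      · obtain ⟨k, hk, -⟩ := hw'
        omega
      · obtain ⟨k, hk, hgk⟩ := both (!g j)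
        rcases hcases k hk with h | rfl
        · exact ⟨k, h, by rw [hgk]; simp⟩
        · simp at hgk
  · have hpos : bostonPos g π i = (π.symm i : ℕ) := by
      rw [bostonPos, if_pos hi', if_neg h2]
    push Not at h2
    obtain ⟨j, hj⟩ : ∃ j, (π.symm j : ℕ) = (π.symm i : ℕ) - 1 :=
      ⟨π ⟨(π.symm i : ℕ) - 1, by omega⟩, by simp⟩
    obtain ⟨m, hm⟩ : ∃ m, (π.symm m : ℕ) = 0 := ⟨π ⟨0, by omega⟩, by simp⟩
    have hgj := h2 j (by omega)
    refine ⟨j, by omega, ?_⟩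
    rw [bostonPos, if_pos ⟨m, by omega, by rw [hgj]; exact h2 m (by omega)⟩, if_neg]
    · omega
    · rintro ⟨k, hk, hgk⟩
      exact hgk (by rw [hgj]; exact h2 k (by omega))

variable [NeZero n] {R : Fin n → Equiv.Perm (Fin n)}

lemma bostonRounds_succ_of_some {π : Equiv.Perm (Fin n)} {k : ℕ} {i x : Fin n}
    (h : bostonRounds R π k i = some x) : bostonRounds R π (k + 1) i = some x := by
  rw [bostonRounds]
  split_ifs
  · simp only [h]
  · exact h

lemma bostonRounds_eq_some_of_le {π : Equiv.Perm (Fin n)} {k l : ℕ} (hkl : k ≤ l) {i x : Fin n}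
    (h : bostonRounds R π k i = some x) : bostonRounds R π l i = some x := by
  induction l, hkl using Nat.le_induction with
  | base => exact h
  | succ l _ ih => exact bostonRounds_succ_of_some ih

lemma bostonRounds_succ_of_none {π : Equiv.Perm (Fin n)} {k : ℕ} (hk : k < n) {i : Fin n}
    (h : bostonRounds R π k i = none) :
    bostonRounds R π (k + 1) i =
      if (∀ j, bostonRounds R π k j ≠ some (R i ⟨k, hk⟩)) ∧
          (∀ j, bostonRounds R π k j = none → R j ⟨k, hk⟩ = R i ⟨k, hk⟩ →
            (π.symm i : ℕ) ≤ (π.symm j : ℕ)) then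
        some (R i ⟨k, hk⟩)
      else none := by
  rw [bostonRounds, dif_pos hk]
  simp only [h]

lemma bostonRounds_two_groups (hn : 3 ≤ n) {g : Fin n → Bool}
    (hsame : ∀ j j', R j 0 = R j' 0 ↔ g j = g j')
    (htail : ∀ j j' (p : Fin n), 1 ≤ (p : ℕ) → (p : ℕ) + 1 < n → R j p = R j' p)
    (π : Equiv.Perm (Fin n)) (hpos : ∀ i, bostonPos g π i < n) (k : ℕ) (hk : k + 1 < n)
    (i : Fin n) :
    bostonRounds R π (k + 1) i =
      if bostonPos g π i ≤ k then some (R i ⟨bostonPos g π i, hpos i⟩) else none := by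
  induction k generalizing i with
  | zero =>
    have h0 : (⟨0, by omega⟩ : Fin n) = 0 := rfl
    rw [bostonRounds_succ_of_none (by omega) (by simp [bostonRounds])]
    by_cases hi : bostonPos g π i = 0
    · have hi' := (bostonPos_eq_zero_iff g π i).1 hi
      push Not at hi'
      rw [if_pos, if_pos hi.le]
      · simp only [hi]
      · refine ⟨by simp [bostonRounds], fun j _ hj => ?_⟩
        rw [h0, hsame] at hj
        by_contra! hlt
        exact hi' j hlt hj
    · have hi' := (bostonPos_eq_zero_iff g π i).not.1 hi
      rw [not_not] at hi'
      obtain ⟨j, hj, hgj⟩ := hi'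
      rw [if_neg, if_neg (by omega)]
      rintro ⟨-, h⟩
      have := h j (by simp [bostonRounds]) ((hsame j i).2 hgj)
      omega
  | succ k ih =>
    have ih := ih (by omega)
    by_cases hi : bostonPos g π i ≤ k
    · rw [if_pos (by omega)]
      apply bostonRounds_succ_of_some
      rw [ih, if_pos hi]
    · rw [bostonRounds_succ_of_none (by omega) (by rw [ih, if_neg hi])]
      have hnone : ∀ j, bostonRounds R π (k + 1) j = none ↔ k < bostonPos g π j := by
        intro j
        rw [ih]
        split_ifs with h
        · simpa using h
        · simpa using h
      by_cases hi1 : bostonPos g π i = k + 1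
      · rw [if_pos, if_pos hi1.le]
        · simp only [hi1]
        · refine ⟨fun j hj => ?_, fun j hj _ => ?_⟩
          · rw [ih] at hj
            split_ifs at hj with h
            rw [Option.some_inj, htail i j _ (by simp) (by simp; omega), (R j).injective.eq_iff,
              Fin.ext_iff] at hj
            simp only at hj
            omega
          · by_contra! hlt
            have := bostonPos_lt_bostonPos g π hlt (by omega)
            have := (hnone j).1 hj
            omega
      · rw [if_neg, if_neg (by omega)]
        rintro ⟨-, h⟩
        obtain ⟨j, hj, hpj⟩ := exists_bostonPos_succ_eq g π (i := i) (by omega)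
        have := h j ((hnone j).2 (by omega)) (htail j i _ (by simp) (by simp; omega))
        omega

lemma bostonAlloc_two_groups (hn : 3 ≤ n) {g : Fin n → Bool}
    (hsame : ∀ j j', R j 0 = R j' 0 ↔ g j = g j')
    (htail : ∀ j j' (p : Fin n), 1 ≤ (p : ℕ) → (p : ℕ) + 1 < n → R j p = R j' p)
    (π : Equiv.Perm (Fin n)) (ht : ∃ j, g j = true) (hf : ∃ j, g j = false) (i : Fin n)
    (hi : bostonPos g π i < n) :
    bostonAlloc R π i = R i ⟨bostonPos g π i, hi⟩ := by
  have hlt := bostonPos_add_one_lt hn g π ht hf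
  have h := bostonRounds_two_groups hn hsame htail π (fun i => by have := hlt i; omega) (n - 2)
    (by omega) i
  rw [if_pos (by have := hlt i; omega)] at h
  rw [bostonAlloc, bostonRounds_eq_some_of_le (by omega) h, Option.getD_some]

lemma bostonRounds_const (P : Equiv.Perm (Fin n)) (π : Equiv.Perm (Fin n)) (k : ℕ) (hk : k ≤ n)
    (i : Fin n) :
    bostonRounds (fun _ => P) π k i =
      if (π.symm i : ℕ) < k then some (P (π.symm i)) else none := by
  induction k generalizing i with
  | zero => simp [bostonRounds]
  | succ k ih =>
    have ih := ih (by omega)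
    by_cases hi : (π.symm i : ℕ) < k
    · rw [if_pos (by omega)]
      apply bostonRounds_succ_of_some
      rw [ih, if_pos hi]
    · rw [bostonRounds_succ_of_none (by omega) (by rw [ih, if_neg hi])]
      have hnone : ∀ j, bostonRounds (fun _ => P) π k j = none ↔ k ≤ (π.symm j : ℕ) := by
        intro j
        rw [ih]
        split_ifs with h
        · simpa using h
        · simpa using h
      by_cases hi1 : (π.symm i : ℕ) = k
      · rw [if_pos, if_pos (by omega)]
        · congr 2
          exact Fin.ext hi1.symm
        · refine ⟨fun j hj => ?_, fun j hj _ => ?_⟩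
          · rw [ih] at hj
            split_ifs at hj with h
            rw [Option.some_inj, P.injective.eq_iff, Fin.ext_iff] at hj
            simp only at hj
            omega
          · have := (hnone j).1 hj
            omega
      · rw [if_neg, if_neg (by omega)]
        rintro ⟨-, h⟩
        have := h (π ⟨k, by omega⟩) ((hnone _).2 (by simp)) rfl
        simp at this
        omega

lemma bostonAlloc_const (P : Equiv.Perm (Fin n)) (π : Equiv.Perm (Fin n)) (i : Fin n) :
    bostonAlloc (fun _ => P) π i = P (π.symm i) := by
  rw [bostonAlloc, bostonRounds_const P π n le_rfl, if_pos (π.symm i).isLt, Option.getD_some]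

lemma bostonAlloc_of_unique_top (π : Equiv.Perm (Fin n)) (i : Fin n)
    (hi : ∀ j, R j 0 = R i 0 → j = i) : bostonAlloc R π i = R i 0 := by
  have h1 : bostonRounds R π 1 i = some (R i 0) := by
    rw [bostonRounds_succ_of_none (Nat.pos_of_neZero n) (by simp [bostonRounds]), if_pos]
    · rfl
    · exact ⟨by simp [bostonRounds], fun j _ hj => by rw [hi j hj]⟩
  rw [bostonAlloc, bostonRounds_eq_some_of_le (Nat.pos_of_neZero n) h1, Option.getD_some]

end Boston

section Counting

variable {n : ℕ}

lemma card_mul_card_first_eq_factorial (S : Finset (Fin n)) {i : Fin n} (hi : i ∈ S) :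
    S.card * (Finset.univ.filter fun π : Equiv.Perm (Fin n) =>
      ∀ j ∈ S, π.symm i ≤ π.symm j).card = n.factorial := by
  have hcard : ∀ s ∈ S, (Finset.univ.filter fun π : Equiv.Perm (Fin n) =>
      ∀ j ∈ S, π.symm s ≤ π.symm j).card = (Finset.univ.filter fun π : Equiv.Perm (Fin n) =>
      ∀ j ∈ S, π.symm i ≤ π.symm j).card := by
    intro s hs
    have hmem : ∀ j ∈ S, Equiv.swap s i j ∈ S := by
      intro j hj
      rw [Equiv.swap_apply_def]
      split_ifs <;> assumption
    refine Finset.card_equiv (Equiv.mulLeft (Equiv.swap s i)) fun π => ?_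
    have happ : ∀ j, (Equiv.swap s i * π).symm j = π.symm (Equiv.swap s i j) := fun j => rfl
    simp only [Finset.mem_filter, Finset.mem_univ, true_and, Equiv.coe_mulLeft, happ,
      Equiv.swap_apply_right]
    constructor
    · exact fun h j hj => h _ (hmem j hj)
    · intro h j hj
      simpa using h _ (hmem j hj)
  rw [← smul_eq_mul, ← Finset.sum_const, ← Finset.sum_congr rfl hcard]
  simp only [Finset.card_filter]
  rw [Finset.sum_comm]
  have hone : ∀ π : Equiv.Perm (Fin n),
      (∑ s ∈ S, if ∀ j ∈ S, π.symm s ≤ π.symm j then 1 else 0) = 1 := by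
    intro π
    obtain ⟨s, hs, hmin⟩ := S.exists_min_image π.symm ⟨i, hi⟩
    rw [Finset.sum_eq_single_of_mem s hs, if_pos hmin]
    intro b hb hbs
    rw [if_neg]
    exact fun h => hbs (π.symm.injective (le_antisymm (h s hs) (hmin b hb)))
  simp only [hone, Finset.sum_const, Finset.card_univ, Fintype.card_perm, Fintype.card_fin,
    smul_eq_mul, mul_one]

lemma card_pair_eq_card_pair {p q i j k : Fin n} (hj : j ≠ i) (hk : k ≠ i) :
    (Finset.univ.filter fun π : Equiv.Perm (Fin n) => π p = i ∧ π q = j).card =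
      (Finset.univ.filter fun π : Equiv.Perm (Fin n) => π p = i ∧ π q = k).card := by
  refine Finset.card_equiv (Equiv.mulLeft (Equiv.swap j k)) fun π => ?_
  simp only [Finset.mem_filter, Finset.mem_univ, true_and, Equiv.coe_mulLeft,
    Equiv.Perm.mul_apply]
  rw [← Equiv.eq_symm_apply (Equiv.swap j k), ← Equiv.eq_symm_apply (Equiv.swap j k),
    Equiv.symm_swap, Equiv.swap_apply_right, Equiv.swap_apply_of_ne_of_ne hj.symm hk.symm]

lemma card_pair_comm (p q i j : Fin n) :
    (Finset.univ.filter fun π : Equiv.Perm (Fin n) => π p = i ∧ π q = j).card =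
      (Finset.univ.filter fun π : Equiv.Perm (Fin n) => π p = j ∧ π q = i).card := by
  refine Finset.card_equiv (Equiv.mulRight (Equiv.swap p q)) fun π => ?_
  simp [and_comm]

lemma card_pair_pos {p q i j : Fin n} (hpq : p ≠ q) (hij : i ≠ j) :
    0 < (Finset.univ.filter fun π : Equiv.Perm (Fin n) => π p = i ∧ π q = j).card := by
  rw [Finset.card_pos]
  refine ⟨Equiv.swap p i * Equiv.swap q (Equiv.swap p i j), ?_⟩
  have h : p ≠ Equiv.swap p i j := fun h =>
    hij (by simpa [eq_comm] using congrArg (Equiv.swap p i) h)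
  simp [Equiv.swap_apply_of_ne_of_ne hpq h]

/-- A sum over orderings in which an agent `i` gains `s` when first, and `w j` when second behind
`j`, is a positive multiple of `∑ j ≠ i, (s + w j)`. -/
lemma exists_sum_perm_eq {p q : Fin n} (hpq : p ≠ q) (i : Fin n) (hn : 2 ≤ n) (s : ℝ)
    (w : Fin n → ℝ) :
    ∃ K : ℝ, 0 < K ∧
      ∑ π : Equiv.Perm (Fin n), (if π p = i then s else if π q = i then w (π p) else 0) =
        K * ∑ j ∈ Finset.univ.erase i, (s + w j) := by
  obtain ⟨k, hk⟩ : ∃ k : Fin n, k ≠ i := by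
    have : Nontrivial (Fin n) := Fin.nontrivial_iff_two_le.2 hn
    exact exists_ne i
  refine ⟨(Finset.univ.filter fun π : Equiv.Perm (Fin n) => π p = i ∧ π q = k).card,
    by exact_mod_cast card_pair_pos hpq hk.symm, ?_⟩
  have hsplit : ∀ π : Equiv.Perm (Fin n),
      (if π p = i then s else if π q = i then w (π p) else 0) =
        ∑ j ∈ Finset.univ.erase i, ((if π p = i ∧ π q = j then s else 0) +
          (if π p = j ∧ π q = i then w j else 0)) := by
    intro π
    have hne : π p ≠ π q := fun h => hpq (π.injective h)
    by_cases h1 : π p = i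
    · have h2 : π q ≠ i := h1 ▸ hne.symm
      simp [h1, h2]
    · by_cases h2 : π q = i
      · simp [h1, h2]
      · simp [h1, h2]
  rw [Finset.sum_congr rfl fun π _ => hsplit π, Finset.sum_comm, Finset.mul_sum]
  refine Finset.sum_congr rfl fun j hj => ?_
  have hj : j ≠ i := Finset.ne_of_mem_erase hj
  rw [Finset.sum_add_distrib, ← Finset.sum_filter, ← Finset.sum_filter, Finset.sum_const,
    Finset.sum_const, card_pair_comm p q j i, card_pair_eq_card_pair hj hk, nsmul_eq_mul,
    nsmul_eq_mul, mul_add]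

end Counting

lemma classEU_lt_classEU {n : ℕ} [NeZero n]
    {mech : (Fin n → Equiv.Perm (Fin n)) → Equiv.Perm (Fin n) → Fin n → Fin n} {v ρ : Fin n → ℝ}
    {prof prof' : Equiv.Perm (Fin (n - 2)) → Fin n → Equiv.Perm (Fin n)} {i : Fin n}
    (h : ∀ τ, 0 < ∑ π : Equiv.Perm (Fin n),
      ((v (mech (prof' τ) π i) + ρ ((prof' τ i).symm (mech (prof' τ) π i))) -
        (v (mech (prof τ) π i) + ρ ((prof τ i).symm (mech (prof τ) π i))))) :
    classEU n mech v ρ prof i < classEU n mech v ρ prof' i := by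
  rw [classEU, classEU]
  refine div_lt_div_of_pos_right (Finset.sum_lt_sum_of_nonempty Finset.univ_nonempty
    fun τ _ => ?_) (by positivity)
  have := h τ
  rw [Finset.sum_sub_distrib] at this
  linarith

section Deviations

variable {n : ℕ} [NeZero n] {v ρ : Fin n → ℝ}

lemma coe_fin_one (hn : 3 ≤ n) : ((1 : Fin n) : ℕ) = 1 := by
  rw [Fin.val_one', Nat.mod_eq_of_lt (by omega)]

/-- In RSD, switching from `x_2` to `x_1` when `m` others rank `x_1` first gains a positive multiple
of `(n - 1) (v_1 - v_2) + (n - 1 - 2 m) (ρ(1) - ρ(2))`. -/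
lemma rsd_sum_deviation (hn : 3 ≤ n) {m : ℕ} (τ : Equiv.Perm (Fin (n - 2))) (i : Fin n)
    (hi : m ≤ (i : ℕ)) :
    ∃ K : ℝ, 0 < K ∧ ∑ π : Equiv.Perm (Fin n),
      ((v (sdAlloc (Function.update (rsdClassProfile n m τ) i (rsdX1Report n τ)) π i) +
          ρ ((Function.update (rsdClassProfile n m τ) i (rsdX1Report n τ) i).symm
            (sdAlloc (Function.update (rsdClassProfile n m τ) i (rsdX1Report n τ)) π i))) -
        (v (sdAlloc (rsdClassProfile n m τ) π i) +
          ρ ((rsdClassProfile n m τ i).symm (sdAlloc (rsdClassProfile n m τ) π i)))) =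
      K * ((n - 1) * (v 0 - v 1) + (n - 1 - 2 * m) * (ρ 0 - ρ 1)) := by
  have h1 := coe_fin_one hn
  have h01 : (0 : Fin n) ≠ 1 := by rw [Ne, Fin.ext_iff, h1, Fin.val_zero]; omega
  have h1' : (⟨1, by omega⟩ : Fin n) = 1 := Fin.ext h1.symm
  obtain ⟨K, hK, hsum⟩ := exists_sum_perm_eq h01 i (by omega) (v 0 - v 1)
    (fun j => if (j : ℕ) < m then -(ρ 0 - ρ 1) else ρ 0 - ρ 1)
  have hx1_zero : rsdX1Report n τ 0 = 0 := rsdX1Report_of_lt_two _ _ (by simp)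
  have hx1_one : rsdX1Report n τ 1 = 1 := rsdX1Report_of_lt_two _ _ (by omega)
  have hx2_zero := rsdX2Report_zero τ
  have hx2_one := rsdX2Report_one hn τ
  set R := rsdClassProfile n m τ with hR
  have hRi : R i = rsdX2Report n τ := by rw [hR, rsdClassProfile, if_neg (by omega)]
  have hRj : ∀ j, R j = if (j : ℕ) < m then rsdX1Report n τ else rsdX2Report n τ := fun j => rfl
  have hRtail : ∀ j (p : Fin n), 2 ≤ (p : ℕ) → R j p = rsdX1Report n τ p := by
    intro j p hp
    rw [hRj]
    split_ifs
    · rfl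
    · exact rsdX2Report_of_two_le hn τ p hp
  set R' := Function.update R i (rsdX1Report n τ) with hR'
  have hR'i : R' i = rsdX1Report n τ := Function.update_self _ _ _
  have hR'j : ∀ j, j ≠ i → R' j = R j := fun j hj => Function.update_of_ne hj _ _
  have hR'tail : ∀ j (p : Fin n), 2 ≤ (p : ℕ) → R' j p = rsdX1Report n τ p := by
    intro j p hp
    by_cases hj : j = i
    · rw [hj, hR'i]
    · rw [hR'j j hj, hRtail j p hp]
  refine ⟨K, hK, ?_⟩
  have hpoint : ∀ π : Equiv.Perm (Fin n),
      (v (sdAlloc R' π i) + ρ ((R' i).symm (sdAlloc R' π i))) -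
        (v (sdAlloc R π i) + ρ ((R i).symm (sdAlloc R π i))) =
      if π 0 = i then v 0 - v 1
      else if π 1 = i then (if (π 0 : ℕ) < m then -(ρ 0 - ρ 1) else ρ 0 - ρ 1) else 0 := by
    intro π
    have hpos : ∀ p, π p = i ↔ (π.symm i : ℕ) = p := by
      intro p
      rw [← Equiv.eq_symm_apply, Fin.ext_iff, eq_comm]
    by_cases ht0 : (π.symm i : ℕ) = 0
    · rw [if_pos ((hpos 0).2 (by simpa using ht0)), sdAlloc_of_eq_zero _ _ ht0,
        sdAlloc_of_eq_zero _ _ ht0, Equiv.symm_apply_apply, Equiv.symm_apply_apply, hRi, hR'i,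
        hx1_zero, hx2_zero]
      ring
    · have hπ0 : π 0 ≠ i := fun h => ht0 (by simpa using (hpos 0).1 h)
      rw [if_neg hπ0]
      by_cases ht1 : (π.symm i : ℕ) = 1
      · rw [if_pos ((hpos 1).2 (by rw [ht1, h1])), sdAlloc_of_eq_one hn _ _ ht1,
          sdAlloc_of_eq_one hn _ _ ht1, hR'j _ hπ0, hRi, hR'i, hx1_zero, hx2_zero, h1', hx1_one,
          hx2_one, hRj]
        have hs0 : (rsdX2Report n τ).symm 0 = 1 := by rw [Equiv.symm_apply_eq, hx2_one]
        have hs1 : (rsdX2Report n τ).symm 1 = 0 := by rw [Equiv.symm_apply_eq, hx2_zero]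
        have hs0' : (rsdX1Report n τ).symm 0 = 0 := by rw [Equiv.symm_apply_eq, hx1_zero]
        have hs1' : (rsdX1Report n τ).symm 1 = 1 := by rw [Equiv.symm_apply_eq, hx1_one]
        by_cases hm : (π 0 : ℕ) < m
        · simp only [hm, if_true, hx1_zero, h01, if_false, hs1, hs1']
          ring
        · simp only [hm, if_false, hx2_zero, h01.symm, if_true, hs0, hs0']
          ring
      · rw [if_neg (fun h => ht1 (by rw [(hpos 1).1 h, h1])),
          sdAlloc_of_two_le hn (fun j j' p hp => by rw [hR'tail j p hp, hR'tail j' p hp]) π i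
            (by omega),
          sdAlloc_of_two_le hn (fun j j' p hp => by rw [hRtail j p hp, hRtail j' p hp]) π i
            (by omega), Equiv.symm_apply_apply, Equiv.symm_apply_apply,
          hRtail _ _ (by omega), hR'tail _ _ (by omega), sub_self]
  rw [Finset.sum_congr rfl fun π _ => hpoint π, hsum]
  congr 1
  have hi_val : (Finset.univ.filter fun j : Fin n => (j : ℕ) < m).card = m := by
    rw [Fin.card_filter_val_lt]
    have := i.isLt
    omega
  have htot : ∑ j : Fin n, ((v 0 - v 1) + if (j : ℕ) < m then -(ρ 0 - ρ 1) else ρ 0 - ρ 1) =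
      n * (v 0 - v 1) + (n - 2 * m) * (ρ 0 - ρ 1) := by
    have hw : ∀ j : Fin n, (if (j : ℕ) < m then -(ρ 0 - ρ 1) else ρ 0 - ρ 1) =
        (ρ 0 - ρ 1) - 2 * (ρ 0 - ρ 1) * (if (j : ℕ) < m then 1 else 0) := by
      intro j
      split_ifs <;> ring
    simp only [hw, Finset.sum_add_distrib, Finset.sum_sub_distrib, ← Finset.mul_sum,
      Finset.sum_boole, hi_val, Finset.sum_const, Finset.card_univ, Fintype.card_fin, nsmul_eq_mul]
    ring
  have herase := Finset.add_sum_erase Finset.univ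
    (fun j : Fin n => (v 0 - v 1) + if (j : ℕ) < m then -(ρ 0 - ρ 1) else ρ 0 - ρ 1)
    (Finset.mem_univ i)
  simp only [htot, if_neg (show ¬ (i : ℕ) < m by omega)] at herase
  linarith

lemma rsdClassEq_bound (hn : 3 ≤ n) {m : ℕ} (hm : m < n) (h : rsdClassEq n m v ρ) :
    ((n : ℝ) - 1) * (v 0 - v 1) ≤ (2 * m - (n - 1)) * (ρ 0 - ρ 1) := by
  by_contra! hlt
  have hi := h ⟨m, hm⟩
  simp only [lt_irrefl, if_false] at hi
  refine absurd hi (not_le.2 (classEU_lt_classEU fun τ => ?_))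
  obtain ⟨K, hK, hsum⟩ := rsd_sum_deviation (v := v) (ρ := ρ) hn τ ⟨m, hm⟩ le_rfl
  rw [hsum]
  exact mul_pos hK (by linarith)

/-- A lower bound on the gain of agent `0` from switching from `x_1` to `x_2` in the Boston
mechanism when groups of sizes `p` and `n - p` rank `x_1` and `x_2` first. -/
lemma boston_sum_deviation (hn : 3 ≤ n) (hρ : Antitone ρ) (hv : prefAssumption v) {p : ℕ}
    (hp : 2 ≤ p) (hpn : p < n) (hpq : n < 2 * p) (τ : Equiv.Perm (Fin (n - 2))) :
    ((n - p + 1 : ℕ) : ℝ)⁻¹ * (v 1 - v ⟨2, by omega⟩ + (ρ 0 - ρ 1)) -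
        (p : ℝ)⁻¹ * (v 0 - v 1 + (v 1 - v ⟨2, by omega⟩ + (ρ 0 - ρ 1))) ≤
      (∑ π : Equiv.Perm (Fin n),
        ((v (bostonAlloc (Function.update (bostonClassProfile n p τ) 0 (bostonX2Report n τ)) π 0) +
          ρ ((Function.update (bostonClassProfile n p τ) 0 (bostonX2Report n τ) 0).symm
            (bostonAlloc (Function.update (bostonClassProfile n p τ) 0
              (bostonX2Report n τ)) π 0))) -
        (v (bostonAlloc (bostonClassProfile n p τ) π 0) +
          ρ ((bostonClassProfile n p τ 0).symm (bostonAlloc (bostonClassProfile n p τ) π 0))))) /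
        n.factorial := by
  have h1 := coe_fin_one hn
  have h01 : (0 : Fin n) ≠ 1 := by rw [Ne, Fin.ext_iff, h1, Fin.val_zero]; omega
  set c := v ⟨2, by omega⟩ with hc
  have hvc : ∀ x : Fin n, 2 ≤ (x : ℕ) → v x = c := fun x hx => hv.2 _ _ hx (by simp)
  set R := bostonClassProfile n p τ with hR
  have hRj : ∀ j, R j = if (j : ℕ) < p then bostonX1Report n τ else bostonX2Report n τ := by
    intro j
    rw [hR, bostonClassProfile, if_neg (by omega)]
  have hR0 : R 0 = bostonX1Report n τ := by rw [hRj, if_pos (by simp; omega)]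
  have hRtail : ∀ j (k : Fin n), 1 ≤ (k : ℕ) → (k : ℕ) + 1 < n → R j k = bostonX1Report n τ k := by
    intro j k hk hkn
    rw [hRj]
    split_ifs
    · rfl
    · exact bostonX2Report_tail hn τ k hk hkn
  set R' := Function.update R 0 (bostonX2Report n τ) with hR'
  have hR'0 : R' 0 = bostonX2Report n τ := Function.update_self _ _ _
  have hR'j : ∀ j, j ≠ 0 → R' j = R j := fun j hj => Function.update_of_ne hj _ _
  have hR'tail : ∀ j (k : Fin n), 1 ≤ (k : ℕ) → (k : ℕ) + 1 < n →
      R' j k = bostonX1Report n τ k := by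
    intro j k hk hkn
    by_cases hj : j = 0
    · rw [hj, hR'0, bostonX2Report_tail hn τ k hk hkn]
    · rw [hR'j j hj, hRtail j k hk hkn]
  have hx1 := bostonX1Report_zero τ
  have hx2 := bostonX2Report_zero τ
  set g : Fin n → Bool := fun j => decide ((j : ℕ) < p) with hg
  set g' : Fin n → Bool := fun j => decide ((j : ℕ) < p ∧ j ≠ 0) with hg'
  have hRtop : ∀ j, R j 0 = if g j then 0 else 1 := by
    intro j
    simp only [hRj, hg, decide_eq_true_eq]
    split_ifs <;> assumption
  have hR'top : ∀ j, R' j 0 = if g' j then 0 else 1 := by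
    intro j
    by_cases hj : j = 0
    · simp [hj, hR'0, hx2, hg']
    · rw [hR'j j hj, hRtop]
      simp [hg, hg', hj]
  have hsame : ∀ j j', R j 0 = R j' 0 ↔ g j = g j' := by
    intro j j'
    rw [hRtop, hRtop]
    cases g j <;> cases g j' <;> simp [h01, h01.symm]
  have hsame' : ∀ j j', R' j 0 = R' j' 0 ↔ g' j = g' j' := by
    intro j j'
    rw [hR'top, hR'top]
    cases g' j <;> cases g' j' <;> simp [h01, h01.symm]
  have ht : ∃ j, g j = true := ⟨0, decide_eq_true (by rw [Fin.val_zero]; omega)⟩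
  have hf : ∃ j, g j = false := ⟨⟨p, hpn⟩, by simp [hg]⟩
  have ht' : ∃ j, g' j = true := ⟨1, decide_eq_true ⟨by rw [h1]; omega, h01.symm⟩⟩
  have hf' : ∃ j, g' j = false := ⟨0, by simp [hg']⟩
  have hlt : ∀ π, bostonPos g π 0 + 1 < n := fun π => bostonPos_add_one_lt hn g π ht hf 0
  have hlt' : ∀ π, bostonPos g' π 0 + 1 < n := fun π => bostonPos_add_one_lt hn g' π ht' hf' 0
  set S₁ : Finset (Fin n) := Finset.univ.filter fun j => (j : ℕ) < p with hS₁
  set S₂ : Finset (Fin n) := insert 0 (Finset.univ.filter fun j => ¬ (j : ℕ) < p) with hS₂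
  have hgsame : ∀ π : Equiv.Perm (Fin n),
      (∃ j, π.symm j < π.symm 0 ∧ g j = g 0) ↔ ¬ ∀ j ∈ S₁, π.symm 0 ≤ π.symm j := by
    intro π
    have h0p : 0 < p := by omega
    simp [hg, hS₁, h0p, and_comm]
  have hgother : ∀ π : Equiv.Perm (Fin n),
      (∃ j, π.symm j < π.symm 0 ∧ g j ≠ g 0) ↔ ¬ ∀ j ∈ S₂, π.symm 0 ≤ π.symm j := by
    intro π
    have h0p : 0 < p := by omega
    simp [hg, hS₂, h0p, and_comm]
  have hg'same : ∀ π : Equiv.Perm (Fin n),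
      (∃ j, π.symm j < π.symm 0 ∧ g' j = g' 0) ↔ ¬ ∀ j ∈ S₂, π.symm 0 ≤ π.symm j := by
    intro π
    rw [← hgother]
    refine exists_congr fun j => and_congr_right fun hj => ?_
    have hj0 : j ≠ 0 := fun h => by simp [h] at hj
    have h0p : 0 < p := by omega
    simp [hg, hg', h0p, hj0]
  have hg'other : ∀ π : Equiv.Perm (Fin n),
      (∃ j, π.symm j < π.symm 0 ∧ g' j ≠ g' 0) ↔ ¬ ∀ j ∈ S₁, π.symm 0 ≤ π.symm j := by
    intro π
    rw [← hgsame]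
    refine exists_congr fun j => and_congr_right fun hj => ?_
    have hj0 : j ≠ 0 := fun h => by simp [h] at hj
    have h0p : 0 < p := by omega
    simp [hg, hg', h0p, hj0]
  have hval : ∀ π, v (bostonAlloc R π 0) + ρ ((R 0).symm (bostonAlloc R π 0)) =
      (if bostonPos g π 0 = 0 then v 0 else c) +
        ρ ⟨bostonPos g π 0, by have := hlt π; omega⟩ := by
    intro π
    have := hlt π
    rw [bostonAlloc_two_groups hn hsame
      (fun j j' k hk hkn => by rw [hRtail j k hk hkn, hRtail j' k hk hkn]) π ht hf 0 (by omega),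
      Equiv.symm_apply_apply]
    congr 1
    split_ifs with h
    · have : (⟨bostonPos g π 0, by omega⟩ : Fin n) = 0 := Fin.ext (by simpa using h)
      rw [this, hR0, hx1]
    · rw [hR0]
      exact hvc _ (two_le_bostonX1Report τ _ (by simp only; omega) this)
  have hval' : ∀ π, v (bostonAlloc R' π 0) + ρ ((R' 0).symm (bostonAlloc R' π 0)) =
      (if bostonPos g' π 0 = 0 then v 1 else c) +
        ρ ⟨bostonPos g' π 0, by have := hlt' π; omega⟩ := by
    intro π
    have := hlt' π
    rw [bostonAlloc_two_groups hn hsame'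
      (fun j j' k hk hkn => by rw [hR'tail j k hk hkn, hR'tail j' k hk hkn]) π ht' hf' 0
      (by omega), Equiv.symm_apply_apply]
    congr 1
    split_ifs with h
    · have : (⟨bostonPos g' π 0, by omega⟩ : Fin n) = 0 := Fin.ext (by simpa using h)
      rw [this, hR'0, hx2]
    · rw [hR'tail _ _ (by simp only; omega) this]
      exact hvc _ (two_le_bostonX1Report τ _ (by simp only; omega) this)
  set κ : Equiv.Perm (Fin n) → ℝ :=
    fun π => if π.symm 0 = 0 then 0 else ρ 1 - ρ (π.symm 0) with hκ
  have hκ_nonneg : ∀ π, 0 ≤ κ π := by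
    intro π
    simp only [hκ]
    split_ifs with h
    · exact le_rfl
    · rw [Fin.ext_iff, Fin.val_zero] at h
      have : (1 : Fin n) ≤ π.symm 0 := by rw [Fin.le_def, h1]; omega
      linarith [hρ this]
  set F₁ : Equiv.Perm (Fin n) → Prop := fun π => ∀ j ∈ S₁, π.symm 0 ≤ π.symm j with hF₁
  set F₂ : Equiv.Perm (Fin n) → Prop := fun π => ∀ j ∈ S₂, π.symm 0 ≤ π.symm j with hF₂
  have hpoint : ∀ π, (v (bostonAlloc R' π 0) + ρ ((R' 0).symm (bostonAlloc R' π 0))) -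
        (v (bostonAlloc R π 0) + ρ ((R 0).symm (bostonAlloc R π 0))) =
      (if F₂ π then 1 else 0) * (v 1 - c + (ρ 0 - ρ 1)) -
        (if F₁ π then 1 else 0) * (v 0 - v 1 + (v 1 - c + (ρ 0 - ρ 1))) +
        ((if F₂ π then κ π else 0) - (if F₁ π then κ π else 0)) := by
    intro π
    have hb : bostonPos g π 0 = if F₁ π then 0 else if F₂ π then (π.symm 0 : ℕ)
        else (π.symm 0 : ℕ) - 1 := by
      rw [bostonPos]
      simp only [hgsame, hgother, ite_not, hF₁, hF₂]
    have hb' : bostonPos g' π 0 = if F₂ π then 0 else if F₁ π then (π.symm 0 : ℕ)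
        else (π.symm 0 : ℕ) - 1 := by
      rw [bostonPos]
      simp only [hg'same, hg'other, ite_not, hF₁, hF₂]
    have hz := bostonPos_eq_zero_iff g π 0
    have hz' := bostonPos_eq_zero_iff g' π 0
    rw [hgsame, not_not] at hz
    rw [hg'same, not_not] at hz'
    have hzero : F₁ π ↔ bostonPos g π 0 = 0 := hz.symm
    have hzero' : F₂ π ↔ bostonPos g' π 0 = 0 := hz'.symm
    have hpos0 : π.symm 0 = 0 → F₁ π ∧ F₂ π := by
      intro h
      simp only [hF₁, hF₂, h]
      exact ⟨fun j _ => Fin.zero_le _, fun j _ => Fin.zero_le _⟩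
    have hidx : ∀ (e : ℕ) (he : e < n) (x : Fin n), e = x → (⟨e, he⟩ : Fin n) = x :=
      fun e he x hx => Fin.ext hx
    rw [hval, hval']
    by_cases hf1 : F₁ π <;> by_cases hf2 : F₂ π
    · simp only [hf1, hf2, if_true] at hb hb' ⊢
      rw [if_pos hb, if_pos hb', hidx _ _ 0 (by simpa using hb'), hidx _ _ 0 (by simpa using hb)]
      ring
    · have hs0 : π.symm 0 ≠ 0 := fun h => hf2 (hpos0 h).2
      have hne := hzero'.not.1 hf2
      simp only [hf1, hf2, if_true, if_false, hκ, hs0] at hb hb' ⊢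
      rw [if_pos hb, if_neg hne, hidx _ _ (π.symm 0) hb', hidx _ _ 0 (by simpa using hb)]
      ring
    · have hs0 : π.symm 0 ≠ 0 := fun h => hf1 (hpos0 h).1
      have hne := hzero.not.1 hf1
      simp only [hf1, hf2, if_true, if_false, hκ, hs0] at hb hb' ⊢
      rw [if_pos hb', if_neg hne, hidx _ _ 0 (by simpa using hb'), hidx _ _ (π.symm 0) hb]
      ring
    · have hne := hzero.not.1 hf1
      have hne' := hzero'.not.1 hf2
      simp only [hf1, hf2, if_false] at hb hb' ⊢
      rw [if_neg hne, if_neg hne']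
      simp only [hb, hb']
      ring
  have hdom : ∑ π, (if F₁ π then κ π else 0) ≤ ∑ π, (if F₂ π then κ π else 0) := by
    rw [← Equiv.sum_comp (Equiv.mulLeft (Equiv.neg (Fin n)))
      (fun π : Equiv.Perm (Fin n) => if F₂ π then κ π else 0)]
    refine Finset.sum_le_sum fun π _ => ?_
    have happ : ∀ j, (Equiv.neg (Fin n) * π).symm j = π.symm (-j) := fun j => rfl
    have hκ' : κ (Equiv.neg (Fin n) * π) = κ π := by
      simp only [hκ, happ, neg_zero]
    simp only [Equiv.coe_mulLeft, hκ']
    by_cases hf1 : F₁ π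
    · rw [if_pos hf1, if_pos]
      intro j hj
      rw [happ, happ, neg_zero]
      by_cases hj0 : j = 0
      · simp [hj0]
      · refine hf1 _ ?_
        have hjp : p ≤ (j : ℕ) := by simpa [hS₂, hj0] using hj
        have hjn := j.isLt
        simp only [hS₁, Finset.mem_filter, Finset.mem_univ, true_and]
        rw [Fin.val_neg', Nat.mod_eq_of_lt (by omega)]
        omega
    · rw [if_neg hf1]
      split_ifs
      · exact hκ_nonneg π
      · exact le_rfl
  have hcard₁ : S₁.card = p := by
    rw [hS₁, Fin.card_filter_val_lt]
    omega
  have hcard₂ : S₂.card = n - p + 1 := by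
    rw [hS₂, Finset.card_insert_of_notMem (by simp; omega), Finset.filter_not,
      Finset.card_sdiff_of_subset (Finset.filter_subset _ _), ← hS₁, hcard₁, Finset.card_univ,
      Fintype.card_fin]
  have hN₁ := card_mul_card_first_eq_factorial S₁ (i := 0) (by simp [hS₁]; omega)
  have hN₂ := card_mul_card_first_eq_factorial S₂ (i := 0) (by simp [hS₂])
  rw [hcard₁] at hN₁
  rw [hcard₂] at hN₂
  have hfac : (0 : ℝ) < n.factorial := by positivity
  have hp0 : (0 : ℝ) < p := by exact_mod_cast (by omega : 0 < p)
  have hq0 : (0 : ℝ) < (n - p + 1 : ℕ) := by positivity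
  have hsum₁ : ∑ π, (if F₁ π then (1 : ℝ) else 0) = (p : ℝ)⁻¹ * n.factorial := by
    rw [Finset.sum_boole, eq_inv_mul_iff_mul_eq₀ hp0.ne']
    exact_mod_cast hN₁
  have hsum₂ : ∑ π, (if F₂ π then (1 : ℝ) else 0) = ((n - p + 1 : ℕ) : ℝ)⁻¹ * n.factorial := by
    rw [Finset.sum_boole, eq_inv_mul_iff_mul_eq₀ hq0.ne']
    exact_mod_cast hN₂
  rw [le_div_iff₀ hfac, Finset.sum_congr rfl fun π _ => hpoint π, Finset.sum_add_distrib,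
    Finset.sum_sub_distrib, Finset.sum_sub_distrib, ← Finset.sum_mul, ← Finset.sum_mul, hsum₁,
    hsum₂]
  linarith

lemma bostonClassEq_bound (hn : 3 ≤ n) (hρ : Antitone ρ) (hv : prefAssumption v) {p : ℕ}
    (hp : 2 ≤ p) (hpn : p < n) (hpq : n < 2 * p) (h : bostonClassEq n p v ρ) :
    ((n - p + 1 : ℕ) : ℝ)⁻¹ * (v 1 - v ⟨2, by omega⟩ + (ρ 0 - ρ 1)) ≤
      (p : ℝ)⁻¹ * (v 0 - v 1 + (v 1 - v ⟨2, by omega⟩ + (ρ 0 - ρ 1))) := by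
  by_contra! hlt
  have hi := h 0
  simp only [Fin.val_zero, show 0 < p by omega, if_true] at hi
  refine absurd hi (not_le.2 (classEU_lt_classEU fun τ => ?_))
  have hfac : (0 : ℝ) < n.factorial := by positivity
  exact (div_pos_iff_of_pos_right hfac).1
    (lt_of_lt_of_le (by linarith) (boston_sum_deviation hn hρ hv hp hpn hpq τ))

/-- If all agents rank `x_1` first in a Boston class equilibrium, then the gap in fundamental values
between `x_1` and `x_2` is at least `n - 1` times that between the first two ranks. -/
lemma bostonClassEq_self_bound (hn : 3 ≤ n) (hρ : Antitone ρ) (hv : prefAssumption v)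
    (h : bostonClassEq n n v ρ) : ((n : ℝ) - 1) * (ρ 0 - ρ 1) ≤ v 0 - v 1 := by
  by_contra! hlt
  have h1 := coe_fin_one hn
  have h01 : (0 : Fin n) ≠ 1 := by rw [Ne, Fin.ext_iff, h1, Fin.val_zero]; omega
  have hi := h 0
  simp only [Fin.val_zero, show 0 < n by omega, if_true] at hi
  refine absurd hi (not_le.2 (classEU_lt_classEU fun τ => ?_))
  have hx1 : rsdX1Report n τ 0 = 0 := rsdX1Report_of_lt_two _ _ (by simp)
  have hprof : bostonClassProfile n n τ = fun _ => rsdX1Report n τ := by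
    rw [bostonClassProfile, if_pos rfl]
  rw [hprof]
  set R' : Fin n → Equiv.Perm (Fin n) :=
    Function.update (fun _ => rsdX1Report n τ) 0 (bostonX2Report n τ) with hR'
  have hR'0 : R' 0 = bostonX2Report n τ := Function.update_self _ _ _
  have hdev : ∀ π, bostonAlloc R' π 0 = 1 := by
    intro π
    rw [bostonAlloc_of_unique_top, hR'0, bostonX2Report_zero]
    intro j hj
    by_contra hj0
    rw [hR'0, bostonX2Report_zero, hR', Function.update_of_ne hj0, hx1] at hj
    exact h01 hj
  have hsymm : (R' 0).symm 1 = 0 := by rw [hR'0, Equiv.symm_apply_eq, bostonX2Report_zero]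
  have hpoint : ∀ π : Equiv.Perm (Fin n),
      (ρ 0 - ρ 1) - (if ∀ j ∈ (Finset.univ : Finset (Fin n)), π.symm 0 ≤ π.symm j then 1 else 0) *
        (v 0 - v 1 + (ρ 0 - ρ 1)) ≤
      (v (bostonAlloc R' π 0) + ρ ((R' 0).symm (bostonAlloc R' π 0))) -
        (v (bostonAlloc (fun _ => rsdX1Report n τ) π 0) +
          ρ ((rsdX1Report n τ).symm (bostonAlloc (fun _ => rsdX1Report n τ) π 0))) := by
    intro π
    rw [hdev, hsymm, bostonAlloc_const, Equiv.symm_apply_apply]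
    by_cases hs : π.symm 0 = 0
    · rw [if_pos (by simp [hs]), hs, hx1]
      linarith
    · rw [if_neg]
      · have hs' := hs
        rw [Fin.ext_iff, Fin.val_zero] at hs'
        have hle : (1 : Fin n) ≤ π.symm 0 := by rw [Fin.le_def, h1]; omega
        have hv1 : v (rsdX1Report n τ (π.symm 0)) ≤ v 1 := by
          by_cases h2 : 2 ≤ (π.symm 0 : ℕ)
          · have := two_le_rsdX1Report τ _ h2
            exact (hv.1 _ _ (by rw [Fin.lt_def, h1]; omega) (by omega)).le
          · have hone : π.symm 0 = 1 := Fin.ext (by rw [h1]; omega)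
            rw [hone, rsdX1Report_of_lt_two τ 1 (by omega)]
        linarith [hρ hle]
      · intro hall
        have := hall (π 0) (Finset.mem_univ _)
        rw [Equiv.symm_apply_apply] at this
        exact hs (le_antisymm this (Fin.zero_le _))
  refine lt_of_lt_of_le ?_ (Finset.sum_le_sum fun π _ => hpoint π)
  have hN := card_mul_card_first_eq_factorial (Finset.univ : Finset (Fin n)) (Finset.mem_univ 0)
  rw [Finset.card_univ, Fintype.card_fin] at hN
  set N := (Finset.univ.filter fun π : Equiv.Perm (Fin n) =>
    ∀ j ∈ (Finset.univ : Finset (Fin n)), π.symm 0 ≤ π.symm j).card with hNdef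
  have hNpos : 0 < N := Nat.pos_of_ne_zero fun h0 => by
    rw [h0, mul_zero] at hN
    exact n.factorial_ne_zero hN.symm
  rw [Finset.sum_sub_distrib, ← Finset.sum_mul, Finset.sum_boole, ← hNdef, Finset.sum_const,
    Finset.card_univ, Fintype.card_perm, Fintype.card_fin, ← hN, nsmul_eq_mul, Nat.cast_mul]
  have hNpos' : (0 : ℝ) < N := by exact_mod_cast hNpos
  have := mul_pos hNpos' (sub_pos.2 hlt)
  linarith

end Deviations

/-- Under the preference assumption, if `n₁R` is an equilibrium of the
random serial dictatorship within the restricted class of profiles and `n₁B ≥ 1` is an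
equilibrium of the Boston mechanism within the restricted class of profiles, then
`n₁R ≥ n₁B`: in any class equilibrium of RSD, weakly more agents rank `x_1` first than
in any class equilibrium of Boston. -/
theorem rsd_class_equilibrium_ranks_x1_first_more (n : ℕ) [NeZero n] (hn : 3 ≤ n)
    (v ρ : Fin n → ℝ) (hρ : Antitone ρ) (hv : prefAssumption v)
    (n₁R n₁B : ℕ) (hR : n₁R ≤ n) (hB1 : 1 ≤ n₁B) (hBn : n₁B ≤ n)
    (heqR : rsdClassEq n n₁R v ρ) (heqB : bostonClassEq n n₁B v ρ) :
    n₁B ≤ n₁R := by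
  by_contra! hlt
  have h1 := coe_fin_one hn
  have hρ01 : 0 ≤ ρ 0 - ρ 1 := sub_nonneg.2 (hρ (Fin.zero_le 1))
  have hv01 : 0 < v 0 - v 1 :=
    sub_pos.2 (hv.1 0 1 (by rw [Fin.lt_def, h1, Fin.val_zero]; omega) (by simp))
  have hv12 : 0 < v 1 - v ⟨2, by omega⟩ :=
    sub_pos.2 (hv.1 1 _ (by rw [Fin.lt_def, h1]; simp) (by omega))
  have hbound := rsdClassEq_bound hn (by omega) heqR
  have hn3 : (3 : ℝ) ≤ n := by exact_mod_cast hn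
  have hRB : (n₁R : ℝ) + 1 ≤ n₁B := by exact_mod_cast hlt
  have hBn' : (n₁B : ℝ) ≤ n := by exact_mod_cast hBn
  have hmajority : (n : ℝ) - 1 < 2 * n₁R := by
    by_contra! h
    nlinarith
  have hρ01' : 0 < ρ 0 - ρ 1 := by
    refine lt_of_le_of_ne hρ01 fun h => ?_
    rw [← h] at hbound
    nlinarith
  have hbound' : ((n : ℝ) - 1) * (v 0 - v 1) ≤ (2 * n₁B - n - 1) * (ρ 0 - ρ 1) :=
    hbound.trans (mul_le_mul_of_nonneg_right (by linarith) hρ01)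
  have hmajority' : n < 2 * n₁R + 1 := by
    have : (n : ℝ) < 2 * n₁R + 1 := by linarith
    exact_mod_cast this
  rcases hBn.lt_or_eq with hBlt | rfl
  · have hboston := bostonClassEq_bound hn hρ hv (by omega) hBlt (by omega) heqB
    have hq : ((n - n₁B + 1 : ℕ) : ℝ) = n - n₁B + 1 := by
      rw [Nat.cast_add, Nat.cast_sub hBn, Nat.cast_one]
    rw [hq, inv_mul_le_iff₀ (by linarith), ← mul_assoc, mul_comm _ (n₁B : ℝ)⁻¹, mul_assoc,
      le_inv_mul_iff₀ (by linarith)] at hboston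
    have hB2 : (2 : ℝ) ≤ n₁B := by exact_mod_cast (by omega : 2 ≤ n₁B)
    nlinarith [mul_pos (show (0 : ℝ) < 2 * n₁B - n - 1 by linarith) hv12,
      mul_nonneg (show (0 : ℝ) ≤ n₁B - 2 by linarith) hv01.le]
  · have hboston := bostonClassEq_self_bound hn hρ hv heqB
    nlinarith
end

section
/- Suppose every agent other than i reports the ranking x_1, x_2, …, x_n (object x_j in position j), while agent i reports a ranking P' that places x_1, …, x_{k'−1} in positions 1, …, k'−1 and places x_{k*} in position k', where 1 ≤ k' < k* ≤ n. Then for every ordering π of the agents, in the serial dictatorship: if i is in position ℓ ≤ k'−1 of π, agent i receives x_ℓ; if i is in position ℓ with k' ≤ ℓ ≤ k*, agent i receives x_{k*}; and if i is in position ℓ > k*, agent i receives some object from {x_{k*+1}, …, x_n}. In particular, agent i never receives any of the objects x_{k'}, …, x_{k*−1}. -/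
theorem topPick_eq_of_forall_lt {n : ℕ} [NeZero n] {P : Equiv.Perm (Fin n)}
    {S : Finset (Fin n)} {p : Fin n} (hp : P p ∉ S) (hlt : ∀ q < p, P q ∈ S) :
    topPick P S = P p := by
  have hne : (Finset.univ.filter fun q => P q ∉ S).Nonempty := ⟨p, by simpa using hp⟩
  rw [topPick, dif_pos hne]
  congr 1
  refine le_antisymm (Finset.min'_le _ _ (by simpa using hp)) (Finset.le_min' _ _ _ ?_)
  intro q hq
  by_contra! h
  exact (Finset.mem_filter.mp hq).2 (hlt q h)

theorem topPick_notMem {n : ℕ} [NeZero n] (P : Equiv.Perm (Fin n))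
    {S : Finset (Fin n)} {x : Fin n} (hx : x ∉ S) : topPick P S ∉ S := by
  have hne : (Finset.univ.filter fun q => P q ∉ S).Nonempty := ⟨P.symm x, by simpa using hx⟩
  rw [topPick, dif_pos hne]
  exact (Finset.mem_filter.mp (Finset.min'_mem _ hne)).2

/-- If the first `k` agents all report the identity ranking, they receive the first
`k` objects. -/
theorem mem_sdAssigned_iff_lt {n : ℕ} [NeZero n] {R : Fin n → Equiv.Perm (Fin n)}
    {π : Equiv.Perm (Fin n)} {k : ℕ} (hk : k ≤ n)
    (hR : ∀ m : Fin n, (m : ℕ) < k → R (π m) = Equiv.refl (Fin n)) (x : Fin n) :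
    x ∈ sdAssigned R π k ↔ (x : ℕ) < k := by
  induction k generalizing x with
  | zero => simp [sdAssigned]
  | succ k ih =>
    have ih := ih (by omega) fun m hm => hR m (by omega)
    have hkn : k < n := hk
    have hpick : topPick (Equiv.refl (Fin n)) (sdAssigned R π k) = ⟨k, hkn⟩ :=
      topPick_eq_of_forall_lt (p := ⟨k, hkn⟩) (by simp [ih])
        fun q hq => (ih _).mpr (Fin.lt_def.mp hq)
    rw [sdAssigned, dif_pos hkn, hR ⟨k, hkn⟩ (Nat.lt_succ_self k), hpick, Finset.mem_union,
      Finset.mem_singleton, ih, Fin.ext_iff]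
    simp only
    omega

/-- Suppose every agent other than `i` reports the identity ranking
`x_1, …, x_n`, while agent `i` reports a ranking `P'` placing `x_1, …, x_{k'-1}` in
positions `1, …, k'-1` and placing `x_{k*}` in position `k'` (here 0-indexed:
positions `p < k'` hold the matching objects and position `k'` holds `k*`, with
`k' < k*`).  Then for every ordering `π`, writing `ℓ = π.symm i` for `i`'s position:
if `ℓ < k'` then `i` receives `x_ℓ`; if `k' ≤ ℓ ≤ k*` then `i` receives `x_{k*}`;
if `ℓ > k*` then `i` receives an object among `x_{k*+1}, …, x_n`; and in particular
`i` never receives any of `x_{k'}, …, x_{k*-1}`. -/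
theorem sd_deviation_allocation (n : ℕ) [NeZero n] (i : Fin n)
    (P' : Equiv.Perm (Fin n)) (R : Fin n → Equiv.Perm (Fin n))
    (hR : ∀ j, j ≠ i → R j = Equiv.refl (Fin n)) (hRi : R i = P')
    (k' kstar : Fin n) (hkk : k' < kstar)
    (hlow : ∀ p : Fin n, (p : ℕ) < (k' : ℕ) → P' p = p)
    (hk' : P' k' = kstar) (π : Equiv.Perm (Fin n)) :
    ((π.symm i : ℕ) < (k' : ℕ) → sdAlloc R π i = π.symm i) ∧
    ((k' : ℕ) ≤ (π.symm i : ℕ) → (π.symm i : ℕ) ≤ (kstar : ℕ) → sdAlloc R π i = kstar) ∧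
    ((kstar : ℕ) < (π.symm i : ℕ) → (kstar : ℕ) < (sdAlloc R π i : ℕ)) ∧
    ¬((k' : ℕ) ≤ (sdAlloc R π i : ℕ) ∧ (sdAlloc R π i : ℕ) < (kstar : ℕ)) := by
  have hmem := mem_sdAssigned_iff_lt (R := R) (π := π) (π.symm i).isLt.le fun m hm =>
    hR _ (by rintro rfl; simp at hm)
  have h₁ : (π.symm i : ℕ) < (k' : ℕ) → sdAlloc R π i = π.symm i := by
    intro h
    rw [sdAlloc, hRi, topPick_eq_of_forall_lt (p := π.symm i), hlow _ h]
    · rw [hmem, hlow _ h]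
      exact lt_irrefl _
    · intro q hq
      rw [hmem, hlow q (lt_trans hq h)]
      exact hq
  have h₂ : (k' : ℕ) ≤ (π.symm i : ℕ) → (π.symm i : ℕ) ≤ (kstar : ℕ) →
      sdAlloc R π i = kstar := by
    intro h h'
    rw [sdAlloc, hRi, topPick_eq_of_forall_lt (p := k'), hk']
    · rw [hmem, hk']
      exact not_lt.mpr h'
    · intro q hq
      rw [hmem, hlow q hq]
      exact lt_of_lt_of_le hq h
  have h₃ : (kstar : ℕ) < (π.symm i : ℕ) → (kstar : ℕ) < (sdAlloc R π i : ℕ) := by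
    intro h
    have hnot := topPick_notMem (R i) (mt (hmem (π.symm i)).mp (lt_irrefl _))
    rw [hmem, not_lt] at hnot
    exact lt_of_lt_of_le h hnot
  refine ⟨h₁, h₂, h₃, fun ⟨ha, hb⟩ => ?_⟩
  rcases lt_or_ge (π.symm i : ℕ) (k' : ℕ) with h | h
  · rw [h₁ h] at ha
    omega
  · rcases le_or_gt (π.symm i : ℕ) (kstar : ℕ) with h' | h'
    · rw [h₂ h h'] at hb
      omega
    · have := h₃ h'
      omega
end

section
/- Suppose agent i's fundamental values satisfy v_i(x_1) ≥ v_i(x_2) ≥ ⋯ ≥ v_i(x_n) and ρ is weakly decreasing. Suppose every agent other than i reports the ranking x_1, x_2, …, x_n, while agent i reports a ranking P' that places x_1, …, x_{k'−1} in positions 1, …, k'−1 and places x_{k*} in position k', where 1 ≤ k' < k* ≤ n. Then agent i's expected utility under the random serial dictatorship is at most (1/n) · Σ_{j=1}^{k'−1} (v_i(x_j) + ρ(j)) + ((n−k'+1)/n) · (v_i(x_{k*}) + ρ(k')). -/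
open Finset in
theorem exists_topPick_eq {n : ℕ} [NeZero n] (P : Equiv.Perm (Fin n)) (S : Finset (Fin n))
    {x : Fin n} (hx : x ∉ S) :
    ∃ p, topPick P S = P p ∧ P p ∉ S ∧ ∀ q, P q ∉ S → p ≤ q := by
  have h : (univ.filter fun p => P p ∉ S).Nonempty := ⟨P.symm x, by simpa using hx⟩
  refine ⟨(univ.filter fun p => P p ∉ S).min' h, by rw [topPick, dif_pos h], ?_, fun q hq => ?_⟩
  · exact (mem_filter.1 (min'_mem _ h)).2
  · exact min'_le _ _ (by simpa using hq)

/-- If all agents other than `i` report the identity ranking, the agents acting before `i` take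
the objects in order. -/
theorem sdAssigned_eq_filter_lt {n : ℕ} [NeZero n] {R : Fin n → Equiv.Perm (Fin n)} {i : Fin n}
    (hR : ∀ j, j ≠ i → R j = Equiv.refl (Fin n)) (π : Equiv.Perm (Fin n)) (k : ℕ)
    (hk : k ≤ (π.symm i : ℕ)) :
    sdAssigned R π k = Finset.univ.filter (fun x : Fin n => (x : ℕ) < k) := by
  induction k with
  | zero => simp [sdAssigned]
  | succ k ih =>
    have hkn : k < n := by omega
    have hne : π ⟨k, hkn⟩ ≠ i := by
      rintro rfl
      simp at hk
    rw [sdAssigned, dif_pos hkn, hR _ hne, ih (by omega)]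
    obtain ⟨p, hp, hpS, hmin⟩ := exists_topPick_eq (Equiv.refl (Fin n))
      (Finset.univ.filter (fun x : Fin n => (x : ℕ) < k)) (x := ⟨k, hkn⟩) (by simp)
    have hpk : p = ⟨k, hkn⟩ := le_antisymm (hmin _ (by simp)) (by simpa [Fin.le_def] using hpS)
    rw [hp, hpk]
    ext x
    simp [Fin.ext_iff]
    omega

open Finset in
/-- The position of a fixed element under a uniformly random permutation is uniform. -/
theorem card_mul_sum_perm_symm_apply {n : ℕ} (g : Fin n → ℝ) (i : Fin n) :
    (n : ℝ) * ∑ π : Equiv.Perm (Fin n), g (π.symm i) = (n.factorial : ℝ) * ∑ t, g t := by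
  have hswap (j : Fin n) :
      ∑ π : Equiv.Perm (Fin n), g (π.symm j) = ∑ π : Equiv.Perm (Fin n), g (π.symm i) := by
    refine Fintype.sum_equiv (Equiv.mulLeft (Equiv.swap i j)) _ _ fun π => ?_
    simp [← Equiv.Perm.inv_def]
  calc (n : ℝ) * ∑ π : Equiv.Perm (Fin n), g (π.symm i)
      = ∑ j : Fin n, ∑ π : Equiv.Perm (Fin n), g (π.symm j) := by simp [hswap]
    _ = ∑ π : Equiv.Perm (Fin n), ∑ j, g (π.symm j) := sum_comm
    _ = ∑ _π : Equiv.Perm (Fin n), ∑ t, g t :=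
        sum_congr rfl fun π _ => Equiv.sum_comp π.symm g
    _ = _ := by simp [Fintype.card_perm]

open Finset in
/-- Suppose agent `i`'s fundamental values satisfy
`v(x_1) ≥ v(x_2) ≥ ⋯ ≥ v(x_n)` and `ρ` is weakly decreasing.  If every agent other
than `i` reports the identity ranking `x_1, …, x_n` while `i` reports `P'` placing
`x_1, …, x_{k'-1}` in positions `1, …, k'-1` and `x_{k*}` in position `k'`
(0-indexed: positions `p < k'` hold matching objects, position `k'` holds `k* > k'`),
then `i`'s RSD expected utility is at most
`(1/n) Σ_{j=1}^{k'-1} (v(x_j) + ρ(j)) + ((n-k'+1)/n) (v(x_{k*}) + ρ(k'))`. -/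
theorem rsd_deviation_expected_utility_bound (n : ℕ) [NeZero n]
    (v ρ : Fin n → ℝ) (hv : Antitone v) (hρ : Antitone ρ) (i : Fin n)
    (P' : Equiv.Perm (Fin n)) (R : Fin n → Equiv.Perm (Fin n))
    (hR : ∀ j, j ≠ i → R j = Equiv.refl (Fin n)) (hRi : R i = P')
    (k' kstar : Fin n) (hkk : k' < kstar)
    (hlow : ∀ p : Fin n, (p : ℕ) < (k' : ℕ) → P' p = p)
    (hk' : P' k' = kstar) :
    rsdEU v ρ R i ≤
      (∑ j ∈ Finset.univ.filter (fun j : Fin n => (j : ℕ) < (k' : ℕ)), (v j + ρ j)) / n +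
        (((n : ℝ) - (k' : ℕ)) / n) * (v kstar + ρ k') := by
  subst hRi
  set c := v kstar + ρ k'
  let g : Fin n → ℝ := fun t => if (t : ℕ) < (k' : ℕ) then v t + ρ t else c
  have hn : (0 : ℝ) < n := Nat.cast_pos.2 (NeZero.pos n)
  have hutil (π : Equiv.Perm (Fin n)) :
      v (sdAlloc R π i) + ρ ((R i).symm (sdAlloc R π i)) ≤ g (π.symm i) := by
    rw [sdAlloc, sdAssigned_eq_filter_lt hR π _ le_rfl]
    generalize π.symm i = t
    obtain ⟨p, hp, hpS, hmin⟩ := exists_topPick_eq (R i)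
      (univ.filter (fun x : Fin n => (x : ℕ) < t)) (x := t) (by simp)
    rw [hp, Equiv.symm_apply_apply]
    simp only [mem_filter, mem_univ, true_and, not_lt] at hpS hmin
    by_cases ht : (t : ℕ) < k'
    · have hpt : p ≤ t := hmin t (by rw [hlow t ht])
      have hpp : R i p = p := hlow p (lt_of_le_of_lt hpt ht)
      have hpt' : p = t := le_antisymm hpt (by rwa [hpp] at hpS)
      simp only [g, if_pos ht, hpp]
      rw [hpt']
    · have hkp : k' ≤ p := by
        by_contra! hlt
        rw [hlow p hlt] at hpS
        have : (p : ℕ) < k' := hlt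
        omega
      have hobj : kstar ≤ R i p := by
        by_cases hts : (t : ℕ) ≤ kstar
        · have hpk : p = k' := le_antisymm (hmin k' (by rwa [hk'])) hkp
          rw [hpk, hk']
        · exact Fin.le_def.2 (by omega)
      simp only [g, if_neg ht]
      exact add_le_add (hv hobj) (hρ hkp)
  have hcard : (#(univ.filter fun t : Fin n => ¬ (t : ℕ) < (k' : ℕ)) : ℝ) = n - (k' : ℕ) := by
    have hlt : #(univ.filter fun t : Fin n => (t : ℕ) < (k' : ℕ)) = k' := by
      rw [← Fin.card_Iio k']
      congr 1
      ext t
      simp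
    have hsum := card_filter_add_card_filter_not (s := (univ : Finset (Fin n)))
      (fun t : Fin n => (t : ℕ) < (k' : ℕ))
    rw [hlt, card_univ, Fintype.card_fin] at hsum
    rw [eq_sub_iff_add_eq']
    exact_mod_cast hsum
  have hg : ∑ t, g t =
      (∑ j ∈ univ.filter (fun j : Fin n => (j : ℕ) < (k' : ℕ)), (v j + ρ j)) +
        ((n : ℝ) - (k' : ℕ)) * c := by
    rw [sum_ite, sum_const, nsmul_eq_mul, hcard]
  calc rsdEU v ρ R i
      ≤ (∑ π : Equiv.Perm (Fin n), g (π.symm i)) / n.factorial := by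
        rw [rsdEU]
        gcongr with π
        exact hutil π
    _ = (∑ t, g t) / n := by
        rw [div_eq_div_iff (by positivity) hn.ne', mul_comm, card_mul_sum_perm_symm_apply, mul_comm]
    _ = _ := by rw [hg]; ring
end

section
/- Define, for real t with 0 < t < n, U^B_1(t) = (1/t)(v_1 + ρ_1) + ((t−1)/t)δ and U^B_2(t) = (1/(n−t))(v_2 + ρ_1) + ((n−t−1)/(n−t))δ, and for real m with 1 ≤ m ≤ n−1 set Δ^B_{1→2}(m) = U^B_1(m) − U^B_2(m−1) and Δ^B_{2→1}(m) = U^B_2(m) − U^B_1(m+1). Then A > B > 0, and for every real m with 1 ≤ m ≤ n−1: Δ^B_{1→2}(m) ≥ 0 and Δ^B_{2→1}(m) ≥ 0 hold simultaneously if and only if ξ ≤ m ≤ ξ + 1. -/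
/-- The average of one value `x` and `t - 1` values `d` exceeds `d` by `(x - d) / t`. -/
lemma one_div_mul_add_sub_one_div_mul {t : ℝ} (x d : ℝ) (ht : t ≠ 0) :
    (1 / t) * x + ((t - 1) / t) * d = (x - d) / t + d := by
  field_simp
  ring

/-- Let `n ≥ 3` be an integer and `v₁ > v₂`, `ρ₁ ≥ ρ₂`,
`δ < v₂ + ρ₂` real numbers.  With `A = v₁ + ρ₁ - δ`, `B = v₂ + ρ₁ - δ` and
`ξ = (nA - B)/(A + B)`, define for `0 < t < n`
`U₁ᴮ(t) = (1/t)(v₁+ρ₁) + ((t-1)/t)δ` and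
`U₂ᴮ(t) = (1/(n-t))(v₂+ρ₁) + ((n-t-1)/(n-t))δ`, and for `1 ≤ m ≤ n-1` set
`Δ₁₂(m) = U₁ᴮ(m) - U₂ᴮ(m-1)` and `Δ₂₁(m) = U₂ᴮ(m) - U₁ᴮ(m+1)`.
Then `A > B > 0`, and for every real `m` with `1 ≤ m ≤ n-1`, the inequalities
`Δ₁₂(m) ≥ 0` and `Δ₂₁(m) ≥ 0` hold simultaneously iff `ξ ≤ m ≤ ξ + 1`. -/
theorem boston_class_equilibrium_range (n : ℕ) (hn : 3 ≤ n)
    (v₁ v₂ ρ₁ ρ₂ δ : ℝ) (hv : v₁ > v₂) (hρ : ρ₁ ≥ ρ₂) (hδ : δ < v₂ + ρ₂) :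
    let A : ℝ := v₁ + ρ₁ - δ
    let B : ℝ := v₂ + ρ₁ - δ
    let ξ : ℝ := ((n : ℝ) * A - B) / (A + B)
    let U₁ : ℝ → ℝ := fun t => (1 / t) * (v₁ + ρ₁) + ((t - 1) / t) * δ
    let U₂ : ℝ → ℝ := fun t =>
      (1 / ((n : ℝ) - t)) * (v₂ + ρ₁) + (((n : ℝ) - t - 1) / ((n : ℝ) - t)) * δ
    let Δ₁₂ : ℝ → ℝ := fun m => U₁ m - U₂ (m - 1)
    let Δ₂₁ : ℝ → ℝ := fun m => U₂ m - U₁ (m + 1)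
    (A > B ∧ B > 0) ∧
      ∀ m : ℝ, 1 ≤ m → m ≤ (n : ℝ) - 1 →
        ((0 ≤ Δ₁₂ m ∧ 0 ≤ Δ₂₁ m) ↔ (ξ ≤ m ∧ m ≤ ξ + 1)) := by
  intro A B ξ U₁ U₂ Δ₁₂ Δ₂₁
  have hB : 0 < B := by simp only [B]; linarith
  have hAB : B < A := by simp only [A, B]; linarith
  have hS : 0 < A + B := by linarith
  refine ⟨⟨hAB, hB⟩, fun m hm hmn => ?_⟩
  have hm0 : 0 < m := by linarith
  have hnm : 0 < (n : ℝ) - m := by linarith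
  have hnm' : 0 < (n : ℝ) - (m - 1) := by linarith
  have hm1 : 0 < m + 1 := by linarith
  have h₁₂ : Δ₁₂ m = A / m - B / ((n : ℝ) - (m - 1)) := by
    simp only [Δ₁₂, U₁, U₂, one_div_mul_add_sub_one_div_mul _ _ hm0.ne',
      one_div_mul_add_sub_one_div_mul _ _ hnm'.ne', A, B]
    ring
  have h₂₁ : Δ₂₁ m = B / ((n : ℝ) - m) - A / (m + 1) := by
    simp only [Δ₂₁, U₁, U₂, one_div_mul_add_sub_one_div_mul _ _ hnm.ne',
      one_div_mul_add_sub_one_div_mul _ _ hm1.ne', A, B]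
    ring
  have hξ : ξ + 1 = ((n : ℝ) + 1) * A / (A + B) := by
    simp only [ξ]
    field_simp
    ring
  rw [h₁₂, h₂₁, sub_nonneg, sub_nonneg, div_le_div_iff₀ hnm' hm0,
    div_le_div_iff₀ hm1 hnm, hξ, le_div_iff₀ hS, div_le_iff₀ hS]
  constructor <;> rintro ⟨h, h'⟩ <;> constructor <;> linarith
end

section
/- Define Δ^{SD}_{2→1}(t) = (v_2 − v_1)/n + (2t − n + 1)(ρ_1 − ρ_2)/(n(n−1)) for real t. Then Δ^{SD}_{2→1}(ξ) = −(v_1 − v_2)·((n−3)ρ_1 + (n+1)ρ_2 + (n−1)(v_1+v_2) − 2(n−1)δ) / (n(n−1)(v_1 + v_2 + 2ρ_1 − 2δ)), and this quantity is strictly negative. -/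
/-- Let `n ≥ 3` be an integer and `v₁ > v₂`, `ρ₁ ≥ ρ₂`,
`δ < v₂ + ρ₂` real numbers; set `A = v₁ + ρ₁ - δ`, `B = v₂ + ρ₁ - δ` and
`ξ = (nA - B)/(A + B)`.  With `Δ₂₁(t) = (v₂ - v₁)/n + (2t - n + 1)(ρ₁ - ρ₂)/(n(n-1))`,
one has
`Δ₂₁(ξ) = -(v₁-v₂)((n-3)ρ₁ + (n+1)ρ₂ + (n-1)(v₁+v₂) - 2(n-1)δ) / (n(n-1)(v₁+v₂+2ρ₁-2δ))`,
and this quantity is strictly negative. -/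
theorem rsd_deviation_gain_at_boston_lower_bound (n : ℕ) (hn : 3 ≤ n)
    (v₁ v₂ ρ₁ ρ₂ δ : ℝ) (hv : v₁ > v₂) (hρ : ρ₁ ≥ ρ₂) (hδ : δ < v₂ + ρ₂) :
    let A : ℝ := v₁ + ρ₁ - δ
    let B : ℝ := v₂ + ρ₁ - δ
    let ξ : ℝ := ((n : ℝ) * A - B) / (A + B)
    let Δ₂₁ : ℝ → ℝ := fun t =>
      (v₂ - v₁) / (n : ℝ) + (2 * t - (n : ℝ) + 1) * (ρ₁ - ρ₂) / ((n : ℝ) * ((n : ℝ) - 1))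
    Δ₂₁ ξ =
        -((v₁ - v₂) * (((n : ℝ) - 3) * ρ₁ + ((n : ℝ) + 1) * ρ₂ +
            ((n : ℝ) - 1) * (v₁ + v₂) - 2 * ((n : ℝ) - 1) * δ)) /
          ((n : ℝ) * ((n : ℝ) - 1) * (v₁ + v₂ + 2 * ρ₁ - 2 * δ)) ∧
      Δ₂₁ ξ < 0 := by
  intro A B ξ Δ₂₁
  have hn' : (3 : ℝ) ≤ n := by exact_mod_cast hn
  have hn₀ : (0 : ℝ) < n := by linarith
  have hn₁ : (0 : ℝ) < n - 1 := by linarith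
  have hS : 0 < v₁ + v₂ + 2 * ρ₁ - 2 * δ := by linarith
  have hξ : 2 * ξ - n + 1 = (n + 1) * (v₁ - v₂) / (v₁ + v₂ + 2 * ρ₁ - 2 * δ) := by
    have hAB : A + B = v₁ + v₂ + 2 * ρ₁ - 2 * δ := by ring
    simp only [ξ, hAB]
    rw [eq_div_iff hS.ne', add_mul, sub_mul, mul_assoc, div_mul_cancel₀ _ hS.ne']
    ring
  have key : Δ₂₁ ξ =
      -((v₁ - v₂) * (((n : ℝ) - 3) * ρ₁ + ((n : ℝ) + 1) * ρ₂ +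
          ((n : ℝ) - 1) * (v₁ + v₂) - 2 * ((n : ℝ) - 1) * δ)) /
        ((n : ℝ) * ((n : ℝ) - 1) * (v₁ + v₂ + 2 * ρ₁ - 2 * δ)) := by
    change (v₂ - v₁) / (n : ℝ) +
      (2 * ξ - (n : ℝ) + 1) * (ρ₁ - ρ₂) / ((n : ℝ) * ((n : ℝ) - 1)) = _
    rw [hξ]
    have := hn₁.ne'
    have := hS.ne'
    field_simp
    ring
  refine ⟨key, ?_⟩
  rw [key]
  refine div_neg_of_neg_of_pos (neg_neg_of_pos (mul_pos (by linarith) ?_)) (by positivity)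
  have h₁ : 0 ≤ ((n : ℝ) - 3) * (ρ₁ - ρ₂) := mul_nonneg (by linarith) (by linarith)
  have h₂ : 0 < ((n : ℝ) - 1) * ((v₁ + ρ₂ - δ) + (v₂ + ρ₂ - δ)) :=
    mul_pos hn₁ (by linarith)
  linarith
end

section
/- Assume additionally ρ_1 > ρ_2 and set α = n/2 + ((n−1)/2)·(v_1−v_2)/(ρ_1−ρ_2). Then ξ < α − 1/2; consequently, for all integers k and m with ξ ≤ k ≤ ξ + 1 and α − 1/2 ≤ m ≤ α + 1/2, one has m ≥ k. -/
/-- Let `n ≥ 3` be an integer and `v₁ > v₂`, `ρ₁ ≥ ρ₂`,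
`δ < v₂ + ρ₂` real numbers; set `A = v₁ + ρ₁ - δ`, `B = v₂ + ρ₁ - δ` and
`ξ = (nA - B)/(A + B)`.  Assume additionally `ρ₁ > ρ₂` and set
`α = n/2 + ((n-1)/2)·(v₁-v₂)/(ρ₁-ρ₂)`.  Then `ξ < α - 1/2`; consequently, for all
integers `k` and `m` with `ξ ≤ k ≤ ξ + 1` and `α - 1/2 ≤ m ≤ α + 1/2`, one has
`m ≥ k`. -/
theorem rsd_class_equilibrium_above_boston (n : ℕ) (hn : 3 ≤ n)
    (v₁ v₂ ρ₁ ρ₂ δ : ℝ) (hv : v₁ > v₂) (hρ : ρ₁ ≥ ρ₂) (hδ : δ < v₂ + ρ₂)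
    (hρ' : ρ₁ > ρ₂) :
    let A : ℝ := v₁ + ρ₁ - δ
    let B : ℝ := v₂ + ρ₁ - δ
    let ξ : ℝ := ((n : ℝ) * A - B) / (A + B)
    let α : ℝ := (n : ℝ) / 2 + (((n : ℝ) - 1) / 2) * ((v₁ - v₂) / (ρ₁ - ρ₂))
    ξ < α - 1 / 2 ∧
      ∀ k m : ℤ, ξ ≤ (k : ℝ) → (k : ℝ) ≤ ξ + 1 → α - 1 / 2 ≤ (m : ℝ) →
        (m : ℝ) ≤ α + 1 / 2 → k ≤ m := by
  intro A B ξ α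
  have hξα : ξ < α - 1 / 2 := by
    have hn' : (3 : ℝ) ≤ n := by exact_mod_cast hn
    have hr : 0 < ρ₁ - ρ₂ := sub_pos.2 hρ'
    have hd : 0 < v₁ - v₂ := sub_pos.2 hv
    have hrB : ρ₁ - ρ₂ < B := by simp only [B]; linarith
    have hAB : A = B + (v₁ - v₂) := by simp only [A, B]; ring
    have hS : 0 < A + B := by linarith
    have hξ : ξ = ((n : ℝ) - 1) / 2 + (v₁ - v₂) / 2 * (((n : ℝ) + 1) / (A + B)) := by
      simp only [ξ]
      field_simp
      rw [hAB]
      ring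
    have hα : α - 1 / 2 =
        ((n : ℝ) - 1) / 2 + (v₁ - v₂) / 2 * (((n : ℝ) - 1) / (ρ₁ - ρ₂)) := by
      simp only [α]
      ring
    have hlt : ((n : ℝ) + 1) / (A + B) < ((n : ℝ) - 1) / (ρ₁ - ρ₂) := by
      rw [div_lt_div_iff₀ hS hr]
      calc ((n : ℝ) + 1) * (ρ₁ - ρ₂) ≤ ((n : ℝ) - 1) * (2 * (ρ₁ - ρ₂)) := by nlinarith
        _ < ((n : ℝ) - 1) * (A + B) := mul_lt_mul_of_pos_left (by linarith) (by linarith)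
    rw [hξ, hα]
    gcongr
  refine ⟨hξα, fun k m _ hk hm _ => ?_⟩
  have hkm : (k : ℝ) < ((m + 1 : ℤ) : ℝ) := by
    push_cast
    linarith
  exact Int.lt_add_one_iff.1 (Int.cast_lt.1 hkm)
end

section
/- Let n ≥ 3 be an integer, let ρ : {1, …, n} → ℝ be weakly decreasing, and let n_1 be an integer with 1 ≤ n_1 ≤ n−1. Define W^{SD} = ( n_1(n_1−1)(ρ(1)+ρ(2)) + 4·n_1(n−n_1)·ρ(1) + (n−n_1)(n−n_1−1)(ρ(1)+ρ(2)) ) / (n(n−1)) + Σ_{j=3}^{n} ρ(j) and W^{B} = 2ρ(1) + Σ_{j=2}^{n−1} ρ(j). Then W^{SD} ≤ W^{B}. -/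
/-- Let `n ≥ 3` be an integer, `ρ` a weakly decreasing real-valued
function on `{1, …, n}`, and `n₁` an integer with `1 ≤ n₁ ≤ n-1`.  With
`Wˢᴰ = (n₁(n₁-1)(ρ(1)+ρ(2)) + 4n₁(n-n₁)ρ(1) + (n-n₁)(n-n₁-1)(ρ(1)+ρ(2)))/(n(n-1))
      + Σ_{j=3}^{n} ρ(j)` and
`Wᴮ = 2ρ(1) + Σ_{j=2}^{n-1} ρ(j)`, one has `Wˢᴰ ≤ Wᴮ`. -/
theorem rsd_welfare_le_boston_welfare (n n₁ : ℕ) (hn : 3 ≤ n)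
    (hn₁ : 1 ≤ n₁) (hn₁' : n₁ ≤ n - 1) (ρ : ℕ → ℝ)
    (hρ : ∀ j k : ℕ, 1 ≤ j → j ≤ k → k ≤ n → ρ k ≤ ρ j) :
    ((n₁ : ℝ) * ((n₁ : ℝ) - 1) * (ρ 1 + ρ 2) + 4 * (n₁ : ℝ) * ((n : ℝ) - (n₁ : ℝ)) * ρ 1 +
          ((n : ℝ) - (n₁ : ℝ)) * ((n : ℝ) - (n₁ : ℝ) - 1) * (ρ 1 + ρ 2)) /
        ((n : ℝ) * ((n : ℝ) - 1)) +
      ∑ j ∈ Finset.Icc 3 n, ρ j ≤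
    2 * ρ 1 + ∑ j ∈ Finset.Icc 2 (n - 1), ρ j := by
  have sum_shift : ∑ j ∈ Finset.Icc 2 (n - 1), ρ j + ρ n = ρ 2 + ∑ j ∈ Finset.Icc 3 n, ρ j := by
    obtain ⟨m, rfl⟩ : ∃ m, n = m + 1 := ⟨n - 1, by lia⟩
    rw [Nat.add_sub_cancel, ← Finset.sum_Icc_succ_top (by lia),
      ← Finset.add_sum_Ioc_eq_sum_Icc (by lia : 2 ≤ m + 1)]
    rfl
  have h12 : ρ 2 ≤ ρ 1 := hρ 1 2 le_rfl (by lia) (by lia)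
  have h2n : ρ n ≤ ρ 2 := hρ 2 n (by lia) (by lia) le_rfl
  have hx : (1 : ℝ) ≤ n₁ := by exact_mod_cast hn₁
  have hy : (n₁ : ℝ) + 1 ≤ n := by exact_mod_cast (by lia : n₁ + 1 ≤ n)
  have hpos : (0 : ℝ) < (n : ℝ) * ((n : ℝ) - 1) := mul_pos (by linarith) (by linarith)
  have same_type_nonneg : 0 ≤ ((n₁ : ℝ) * (n₁ - 1) + (n - n₁) * (n - n₁ - 1)) * (ρ 1 - ρ 2) :=
    mul_nonneg (add_nonneg (mul_nonneg (by linarith) (by linarith))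
      (mul_nonneg (by linarith) (by linarith))) (by linarith)
  have two_best : ((n₁ : ℝ) * ((n₁ : ℝ) - 1) * (ρ 1 + ρ 2) +
      4 * (n₁ : ℝ) * ((n : ℝ) - (n₁ : ℝ)) * ρ 1 +
      ((n : ℝ) - (n₁ : ℝ)) * ((n : ℝ) - (n₁ : ℝ) - 1) * (ρ 1 + ρ 2)) /
        ((n : ℝ) * ((n : ℝ) - 1)) ≤ 2 * ρ 1 := by
    rw [div_le_iff₀ hpos]
    linarith
  linarith
end
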